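/- arXiv:1903.08979 — 9 statements merged into one kernel-verified Lean document; each statement's English description precedes it below -/
import Mathlib

section
/- (Springer's theorem) Let k be a field of characteristic different from 2 and let Q be a quadratic form on the k-vector space k^n. Let L/k be a finite field extension whose degree [L:k] is odd. If the base change Q_L of Q to L is isotropic (i.e., there exists a nonzero vector w in L^n with Q_L(w) = 0), then Q itself is isotropic (i.e., there exists a nonzero vector v in k^n with Q(v) = 0). -/
/-- The base change of a quadratic form on `k^n` along a field extension `k → K`,
realized as a quadratic form on `K^n` by transporting `QuadraticForm.baseChange`
along the canonical `K`-linear equivalence `K ⊗[k] (Fin n → k) ≃ₗ[K] (Fin n → K)`. -/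
noncomputable def QuadraticForm.baseChangePi {k : Type*} [Field k] (K : Type*) [Field K]
    [Algebra k K] (h2 : (2 : k) ≠ 0) {n : ℕ} (Q : QuadraticForm k (Fin n → k)) :
    QuadraticForm K (Fin n → K) :=
  letI : Invertible (2 : k) := invertibleOfNonzero h2
  (Q.baseChange K).comp (TensorProduct.piScalarRight k K K (Fin n)).symm.toLinearMap

open Polynomial

/-- The value at `v` of the quadratic form with Gram matrix `M`. -/
def Matrix.quadEval {ι R : Type*} [Fintype ι] [CommRing R] (M : Matrix ι ι R) (v : ι → R) : R :=
  ∑ i, ∑ j, M i j * v i * v j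

theorem Polynomial.exists_irreducible_odd_natDegree_dvd {K : Type*} [Field K] {h : K[X]}
    (hodd : Odd h.natDegree) : ∃ q, Irreducible q ∧ Odd q.natDegree ∧ q ∣ h := by
  induction h using WfDvdMonoid.induction_on_irreducible with
  | zero => simp at hodd
  | unit u hu => simp [natDegree_eq_zero_of_isUnit hu] at hodd
  | mul a i ha hi ih =>
    rw [natDegree_mul hi.ne_zero ha, Nat.odd_add] at hodd
    by_cases hio : Odd i.natDegree
    · exact ⟨i, hi, hio, dvd_mul_right _ _⟩
    · obtain ⟨q, hq, hqo, hqa⟩ := ih (by grind)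
      exact ⟨q, hq, hqo, hqa.mul_left i⟩

namespace Matrix

section CommRing

variable {ι R S : Type*} [Fintype ι] [CommRing R] [CommRing S]

theorem quadEval_map (φ : R →+* S) (M : Matrix ι ι R) (v : ι → R) :
    (M.map φ).quadEval (φ ∘ v) = φ (M.quadEval v) := by
  simp [quadEval]

theorem quadEval_mul_left (M : Matrix ι ι R) (c : R) (v : ι → R) :
    M.quadEval (fun i => c * v i) = c ^ 2 * M.quadEval v := by
  simp only [quadEval, Finset.mul_sum]
  exact Finset.sum_congr rfl fun i _ => Finset.sum_congr rfl fun j _ => by ring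

theorem dvd_quadEval_iff_of_dvd_sub (M : Matrix ι ι R) {p : R} {v w : ι → R}
    (h : ∀ i, p ∣ v i - w i) : p ∣ M.quadEval v ↔ p ∣ M.quadEval w := by
  have hvw : Ideal.Quotient.mk (Ideal.span {p}) ∘ v = Ideal.Quotient.mk (Ideal.span {p}) ∘ w :=
    funext fun i => (Ideal.Quotient.mk_eq_mk_iff_sub_mem _ _).2 (Ideal.mem_span_singleton.2 (h i))
  rw [← Ideal.mem_span_singleton, ← Ideal.mem_span_singleton, ← Ideal.Quotient.eq_zero_iff_mem,
    ← Ideal.Quotient.eq_zero_iff_mem, ← quadEval_map, ← quadEval_map, hvw]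

theorem natDegree_quadEval_map_C_le (M : Matrix ι ι R) {f : ι → R[X]} {m : ℕ}
    (hf : ∀ i, (f i).natDegree ≤ m) : ((M.map C).quadEval f).natDegree ≤ m + m :=
  natDegree_sum_le_of_forall_le _ _ fun i _ => natDegree_sum_le_of_forall_le _ _ fun j _ =>
    natDegree_mul_le_of_le ((natDegree_C_mul_le _ _).trans (hf i)) (hf j)

theorem coeff_quadEval_map_C (M : Matrix ι ι R) {f : ι → R[X]} {m : ℕ}
    (hf : ∀ i, (f i).natDegree ≤ m) :
    ((M.map C).quadEval f).coeff (m + m) = M.quadEval fun i => (f i).coeff m := by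
  simp only [quadEval, finsetSum_coeff, map_apply]
  refine Finset.sum_congr rfl fun i _ => Finset.sum_congr rfl fun j _ => ?_
  rw [coeff_mul_add_eq_of_natDegree_le ((natDegree_C_mul_le _ _).trans (hf i)) (hf j), coeff_C_mul]

end CommRing

theorem exists_quadEval_eq_zero_of_irreducible_dvd {ι K : Type*} [Fintype ι] [Field K]
    (M : Matrix ι ι K) {p : K[X]} (hp : Irreducible p) (hodd : Odd p.natDegree) {f : ι → K[X]}
    (hpf : ∃ i, ¬ p ∣ f i) (hf : p ∣ (M.map C).quadEval f) :
    ∃ v : ι → K, v ≠ 0 ∧ M.quadEval v = 0 := by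
  classical
  induction hd : p.natDegree using Nat.strong_induction_on generalizing p f with
  | _ d ih =>
  subst hd
  let : NormalizedGCDMonoid K[X] := UniqueFactorizationMonoid.toNormalizedGCDMonoid _
  set r : ι → K[X] := fun i => f i % p with hr
  have hsub : ∀ i, p ∣ f i - r i := fun i =>
    ⟨f i / p, by rw [hr, sub_eq_iff_eq_add, EuclideanDomain.div_add_mod]⟩
  have hrp : ∃ i, ¬ p ∣ r i := hpf.imp fun i hi h => hi ((dvd_sub_left h).1 (hsub i))
  have hrdvd := (dvd_quadEval_iff_of_dvd_sub (M.map C) hsub).1 hf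
  have hrdeg : ∀ i, (r i).natDegree < p.natDegree := fun i =>
    natDegree_mod_lt _ hp.natDegree_pos.ne'
  obtain ⟨i₀, hi₀⟩ := hrp
  obtain ⟨g, hg, hg1⟩ := Finset.extract_gcd r ⟨i₀, Finset.mem_univ _⟩
  set c := Finset.univ.gcd r
  have hc : ¬ p ∣ c := fun h => hi₀ (h.trans (Finset.gcd_dvd (Finset.mem_univ _)))
  have hc0 : c ≠ 0 := fun h => hc (h ▸ dvd_zero _)
  have hrg : r = fun i => c * g i := funext fun i => hg i (Finset.mem_univ _)
  have hgdvd : p ∣ (M.map C).quadEval g := by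
    rw [hrg, quadEval_mul_left] at hrdvd
    exact (hp.prime.dvd_or_dvd hrdvd).resolve_left fun h => hc (hp.prime.dvd_of_dvd_pow h)
  have hgdeg : ∀ i, (g i).natDegree < p.natDegree := fun i => by
    by_cases h0 : g i = 0
    · simpa [h0] using hp.natDegree_pos
    · refine lt_of_le_of_lt ?_ (hrdeg i)
      rw [hrg]
      exact natDegree_le_of_dvd (dvd_mul_left _ _) (mul_ne_zero hc0 h0)
  have hg0 : ∃ i, g i ≠ 0 := by
    by_contra! h
    exact hi₀ (by simp [hrg, h])
  obtain ⟨i₁, hi₁, hmax⟩ := Finset.exists_max_image {i | g i ≠ 0} (fun i => (g i).natDegree)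
    (hg0.imp fun i hi => by simpa using hi)
  have hi₁ : g i₁ ≠ 0 := by simpa using hi₁
  set m := (g i₁).natDegree
  have hgm : ∀ i, (g i).natDegree ≤ m := fun i => by
    by_cases h0 : g i = 0
    · simp [h0]
    · exact hmax i (by simpa using h0)
  by_cases hlead : M.quadEval (fun i => (g i).coeff m) = 0
  · exact ⟨_, fun h => hi₁ (leadingCoeff_eq_zero.1 (congrFun h i₁)), hlead⟩
  rw [← coeff_quadEval_map_C M hgm] at hlead
  have hqdeg : ((M.map C).quadEval g).natDegree = m + m :=
    le_antisymm (natDegree_quadEval_map_C_le M hgm) (le_natDegree_of_ne_zero hlead)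
  obtain ⟨h, hh⟩ := hgdvd
  have hq0 : p * h ≠ 0 := fun h0 => hlead (by rw [hh, h0, coeff_zero])
  have hh0 : h ≠ 0 := right_ne_zero_of_mul hq0
  have hdeg : p.natDegree + h.natDegree = m + m := by
    rw [← natDegree_mul hp.ne_zero hh0, ← hh, hqdeg]
  have hhodd : Odd h.natDegree := by
    have := hgdeg i₁
    grind
  obtain ⟨q, hq, hqodd, hqh⟩ := exists_irreducible_odd_natDegree_dvd hhodd
  have hlt : q.natDegree < p.natDegree := by
    have := natDegree_le_of_dvd hqh hh0
    have := hgdeg i₁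
    omega
  refine ih _ hlt hq hqodd (f := g) ?_ (hh ▸ hqh.mul_left p) rfl
  by_contra! hall
  exact hq.not_isUnit (isUnit_of_dvd_one (hg1 ▸ Finset.dvd_gcd fun i _ => hall i))

theorem exists_quadEval_eq_zero_of_powerBasis {ι K L : Type*} [Fintype ι] [Field K] [Field L]
    [Algebra K L] (pb : PowerBasis K L) (hodd : Odd (Module.finrank K L)) (M : Matrix ι ι K)
    (h : ∃ w : ι → L, w ≠ 0 ∧ (M.map (algebraMap K L)).quadEval w = 0) :
    ∃ v : ι → K, v ≠ 0 ∧ M.quadEval v = 0 := by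
  obtain ⟨w, hw, hMw⟩ := h
  choose f hf using fun i => pb.exists_eq_aeval' (w i)
  have hwf : w = (aeval pb.gen : K[X] →ₐ[K] L).toRingHom ∘ f := funext hf
  have hM : M.map (algebraMap K L) = (M.map C).map (aeval pb.gen : K[X] →ₐ[K] L).toRingHom := by
    ext; simp
  refine exists_quadEval_eq_zero_of_irreducible_dvd M (minpoly.irreducible pb.isIntegral_gen)
    (by rwa [pb.natDegree_minpoly, ← pb.finrank]) (f := f) ?_ ?_
  · by_contra! hall
    exact hw (funext fun i => (hf i).trans ((minpoly.dvd_iff).1 (hall i)))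
  · rw [hM, hwf, quadEval_map] at hMw
    exact minpoly.dvd _ _ hMw

theorem exists_quadEval_eq_zero_of_odd_finrank {ι K L : Type*} [Fintype ι] [Field K] [Field L]
    [Algebra K L] [FiniteDimensional K L] (hodd : Odd (Module.finrank K L)) (M : Matrix ι ι K)
    (h : ∃ w : ι → L, w ≠ 0 ∧ (M.map (algebraMap K L)).quadEval w = 0) :
    ∃ v : ι → K, v ≠ 0 ∧ M.quadEval v = 0 := by
  have key : ∀ E : IntermediateField K L,
      (∃ w : ι → E, w ≠ 0 ∧ (M.map (algebraMap K E)).quadEval w = 0) →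
        ∃ v : ι → K, v ≠ 0 ∧ M.quadEval v = 0 := by
    refine fun E => IntermediateField.induction_on_adjoin (fun E : IntermediateField K L =>
      (∃ w : ι → E, w ≠ 0 ∧ (M.map (algebraMap K E)).quadEval w = 0) →
        ∃ v : ι → K, v ≠ 0 ∧ M.quadEval v = 0) ?_ ?_ E
    · exact exists_quadEval_eq_zero_of_powerBasis
        ((IntermediateField.adjoin.powerBasis (isIntegral_zero (R := K) (B := L))).map
          (IntermediateField.equivOfEq IntermediateField.adjoin_zero)) (by simp) M
    · rintro E x ih ⟨w, hw, hMw⟩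
      refine ih (exists_quadEval_eq_zero_of_powerBasis
        (IntermediateField.adjoin.powerBasis (Algebra.IsIntegral.isIntegral (R := E) x)) ?_ _
        ⟨w, hw, ?_⟩)
      · rw [← Module.finrank_mul_finrank K E L, Nat.odd_mul,
          ← Module.finrank_mul_finrank E (IntermediateField.adjoin E {x}) L, Nat.odd_mul] at hodd
        exact hodd.2.1
      · rw [Matrix.map_map]
        exact hMw
  obtain ⟨w, hw, hMw⟩ := h
  let e : L ≃ₐ[K] (⊤ : IntermediateField K L) := IntermediateField.topEquiv.symm
  refine key ⊤ ⟨e ∘ w, fun h0 => hw (funext fun i => e.injective ?_), ?_⟩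
  · simpa using congrFun h0 i
  · have hM : M.map (algebraMap K (⊤ : IntermediateField K L)) =
        (M.map (algebraMap K L)).map (e : L →+* (⊤ : IntermediateField K L)) := by
      ext; simp
    have := quadEval_map (e : L →+* (⊤ : IntermediateField K L)) (M.map (algebraMap K L)) w
    rw [hMw, map_zero] at this
    rw [hM]
    exact this

end Matrix

theorem LinearMap.BilinForm.apply_self_eq_quadEval {ι R : Type*} [Fintype ι] [DecidableEq ι]
    [CommRing R] (B : LinearMap.BilinForm R (ι → R)) (v : ι → R) :
    B v v = Matrix.quadEval (fun i j => B (Pi.single i 1) (Pi.single j 1)) v := by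
  conv_lhs => rw [pi_eq_sum_univ' v]
  simp only [map_sum, map_smul, LinearMap.sum_apply, LinearMap.smul_apply, smul_eq_mul,
    Matrix.quadEval]
  simp only [Finset.mul_sum]
  rw [Finset.sum_comm]
  exact Finset.sum_congr rfl fun i _ => Finset.sum_congr rfl fun j _ => by ring

theorem QuadraticForm.baseChangePi_apply {k : Type*} [Field k] (K : Type*) [Field K]
    [Algebra k K] (h2 : (2 : k) ≠ 0) [Invertible (2 : k)] {n : ℕ}
    (Q : QuadraticForm k (Fin n → k)) (w : Fin n → K) :
    Q.baseChangePi K h2 w = Matrix.quadEval (Matrix.map (fun i j : Fin n =>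
      QuadraticMap.associated Q (Pi.single i 1) (Pi.single j 1)) (algebraMap k K)) w := by
  let : Invertible (2 : K) :=
    (Invertible.map (algebraMap k K) 2).copy _ (map_ofNat _ 2).symm
  rw [← QuadraticMap.associated_eq_self_apply K, LinearMap.BilinForm.apply_self_eq_quadEval]
  congr 1
  ext i j
  have hQ : Q.baseChangePi K h2 =
      (Q.baseChange K).comp (TensorProduct.piScalarRight k K K (Fin n)).symm.toLinearMap := by
    unfold baseChangePi
    congr!
    exact Subsingleton.elim _ _
  rw [hQ, QuadraticMap.associated_comp, associated_baseChange]
  simp [TensorProduct.piScalarRight_symm_single, Matrix.map, Algebra.algebraMap_eq_smul_one]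

/-- **Springer's theorem**: if a quadratic form over a field `k` of characteristic `≠ 2`
becomes isotropic over a finite field extension `L/k` of odd degree, then it is already
isotropic over `k`. -/
theorem springer_odd_degree_isotropic {n : ℕ} {k L : Type*} [Field k] [Field L] [Algebra k L]
    (h2 : (2 : k) ≠ 0) [FiniteDimensional k L] (hodd : Odd (Module.finrank k L))
    (Q : QuadraticForm k (Fin n → k))
    (hiso : ∃ w : Fin n → L, w ≠ 0 ∧ Q.baseChangePi L h2 w = 0) :
    ∃ v : Fin n → k, v ≠ 0 ∧ Q v = 0 := by
  let : Invertible (2 : k) := invertibleOfNonzero h2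
  obtain ⟨w, hw, hQw⟩ := hiso
  rw [QuadraticForm.baseChangePi_apply] at hQw
  obtain ⟨v, hv, hQv⟩ := Matrix.exists_quadEval_eq_zero_of_odd_finrank hodd _ ⟨w, hw, hQw⟩
  refine ⟨v, hv, ?_⟩
  rw [← QuadraticMap.associated_eq_self_apply k, LinearMap.BilinForm.apply_self_eq_quadEval]
  exact hQv
end

section
/- (Amer's theorem) Let k be a field of characteristic different from 2, let f and g be quadratic forms on k^{n+1}, and let d ≥ 1 be an integer. Let K = k(t) be the field of rational functions in one variable and consider the quadratic form h = f_K + t·g_K on K^{n+1}, where f_K and g_K are the base changes of f and g to K and t·g_K denotes the scalar multiple of g_K by t ∈ K. Then there exists a d-dimensional K-subspace of K^{n+1} on which h vanishes identically if and only if there exists a d-dimensional k-subspace of k^{n+1} on which both f and g vanish identically. -/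
open Polynomial

section Amer

variable {k : Type*} [Field k] {ι κ : Type*} [Fintype ι] [DecidableEq ι]

theorem LinearIndependent.update_sum_smul {R M : Type*} [CommRing R] [IsDomain R]
    [AddCommGroup M] [Module R M] [Fintype κ] [DecidableEq κ] {w : κ → M}
    (hw : LinearIndependent R w) (p : κ → R) {j : κ} (hj : p j ≠ 0) :
    LinearIndependent R (Function.update w j (∑ i, p i • w i)) := by
  rw [Fintype.linearIndependent_iff] at hw ⊢
  intro c hc
  have key : ∑ i, ((if i = j then 0 else c i) + c j * p i) • w i = 0 := by
    rw [← hc, ← Finset.add_sum_erase _ (fun i => c i • Function.update w j _ i)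
      (Finset.mem_univ j), Function.update_self]
    simp only [add_smul, Finset.sum_add_distrib, Finset.smul_sum, mul_smul]
    rw [add_comm]
    congr 1
    rw [← Finset.add_sum_erase _ _ (Finset.mem_univ j)]
    simp only [if_true, zero_smul, zero_add]
    refine Finset.sum_congr rfl fun i hi => ?_
    rw [if_neg (Finset.ne_of_mem_erase hi), Function.update_of_ne (Finset.ne_of_mem_erase hi)]
  have h := hw _ key
  have hcj : c j = 0 := by simpa [hj] using h j
  intro i
  by_cases hij : i = j
  · rw [hij, hcj]
  · simpa [hij, hcj] using h i

namespace Matrix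

/-- The bilinear form over `k[X]` attached to the matrix pencil `A + X B`. -/
noncomputable def pencilForm (A B : Matrix ι ι k) : LinearMap.BilinForm k[X] (ι → k[X]) :=
  Matrix.toBilin' (Matrix.of fun i j => C (A i j) + X * C (B i j))

variable {A B : Matrix ι ι k}

theorem pencilForm_apply (v w : ι → k[X]) :
    pencilForm A B v w = ∑ i, ∑ j, v i * (C (A i j) + X * C (B i j)) * w j := by
  simp [pencilForm, Matrix.toBilin'_apply]

theorem pencilForm_comm (hA : A.IsSymm) (hB : B.IsSymm) (v w : ι → k[X]) :
    pencilForm A B v w = pencilForm A B w v := by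
  rw [pencilForm_apply, pencilForm_apply, Finset.sum_comm]
  refine Finset.sum_congr rfl fun i _ => Finset.sum_congr rfl fun j _ => ?_
  rw [hA.apply, hB.apply]
  ring

theorem pencilForm_C (u v : ι → k) :
    pencilForm A B (fun i => C (u i)) (fun i => C (v i)) =
      C (A.toBilin' u v) + X * C (B.toBilin' u v) := by
  simp only [pencilForm_apply, Matrix.toBilin'_apply, map_sum, map_mul, Finset.mul_sum,
    ← Finset.sum_add_distrib]
  refine Finset.sum_congr rfl fun i _ => Finset.sum_congr rfl fun j _ => ?_
  ring

theorem degree_pencilForm_lt {v w : ι → k[X]} {m l : ℕ} (hv : ∀ i, (v i).degree < m)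
    (hw : ∀ i, (w i).degree < l) : (pencilForm A B v w).degree < (m + l : ℕ) := by
  rw [pencilForm_apply, ← mem_degreeLT]
  refine Submodule.sum_mem _ fun i _ => Submodule.sum_mem _ fun j _ => ?_
  rw [mem_degreeLT]
  by_cases hvi : v i = 0
  · simp [hvi]
  by_cases hwj : w j = 0
  · simp [hwj]
  have h1 := hv i
  have h2 := hw j
  rw [degree_eq_natDegree hvi, Nat.cast_lt] at h1
  rw [degree_eq_natDegree hwj, Nat.cast_lt] at h2
  have h3 : (C (A i j) + X * C (B i j)).natDegree ≤ 1 := by compute_degree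
  refine (degree_le_natDegree).trans_lt (Nat.cast_lt.2 ?_)
  have h4 := natDegree_mul_le (p := v i * (C (A i j) + X * C (B i j))) (q := w j)
  have h5 := natDegree_mul_le (p := v i) (q := C (A i j) + X * C (B i j))
  omega

theorem coeff_pencilForm {v w : ι → k[X]} {m l : ℕ} (hv : ∀ i, (v i).natDegree ≤ m)
    (hw : ∀ i, (w i).natDegree ≤ l) : (pencilForm A B v w).coeff (m + 1 + l) =
      B.toBilin' (fun i => (v i).coeff m) (fun i => (w i).coeff l) := by
  rw [pencilForm_apply, Matrix.toBilin'_apply]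
  simp only [finsetSum_coeff]
  refine Finset.sum_congr rfl fun i _ => Finset.sum_congr rfl fun j _ => ?_
  have h3 : (C (A i j) + X * C (B i j)).natDegree ≤ 1 := by compute_degree
  rw [coeff_mul_add_eq_of_natDegree_le (natDegree_mul_le_of_le (hv i) h3) (hw j),
    coeff_mul_add_eq_of_natDegree_le (hv i) h3]
  simp [coeff_C]

/-- A linearly independent family of polynomial vectors, with degrees bounded by `N`, spanning a
totally isotropic subspace for the pencil `A + X B`. -/
structure IsPencilIsotropic (A B : Matrix ι ι k) (N : κ → ℕ) (w : κ → ι → k[X]) : Prop where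
  linearIndependent : LinearIndependent k[X] w
  isotropic : ∀ i j, pencilForm A B (w i) (w j) = 0
  degree_lt : ∀ i c, (w i c).degree < N i

namespace IsPencilIsotropic

variable {N : κ → ℕ} {w : κ → ι → k[X]}

theorem pos (h : IsPencilIsotropic A B N w) (i : κ) : 0 < N i := by
  rw [Nat.pos_iff_ne_zero]
  intro h0
  refine h.linearIndependent.ne_zero i (funext fun c => ?_)
  have := h.degree_lt i c
  rw [h0] at this
  simpa using this

theorem natDegree_le (h : IsPencilIsotropic A B N w) (i : κ) (c : ι) :
    (w i c).natDegree ≤ N i - 1 := by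
  have h1 := h.pos i
  by_cases h0 : w i c = 0
  · simp [h0]
  · have := (natDegree_lt_iff_degree_lt h0).2 (h.degree_lt i c)
    omega

/-- The vectors of coefficients in the top degree allowed by `N`. -/
def top (N : κ → ℕ) (w : κ → ι → k[X]) (i : κ) : ι → k := fun c => (w i c).coeff (N i - 1)

theorem toBilin'_top (h : IsPencilIsotropic A B N w) (i j : κ) :
    B.toBilin' (top N w i) (top N w j) = 0 := by
  unfold top
  rw [← coeff_pencilForm (A := A) (h.natDegree_le i) (h.natDegree_le j), h.isotropic, coeff_zero]

theorem degree_sub_top (h : IsPencilIsotropic A B N w) (i : κ) (c : ι) :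
    (w i c - X ^ (N i - 1) * C (top N w i c)).degree < ((N i - 1 : ℕ) : WithBot ℕ) := by
  rw [degree_lt_iff_coeff_zero]
  intro l hl
  rcases hl.eq_or_lt with rfl | hl
  · simp [top]
  · rw [coeff_sub, mul_comm, coeff_C_mul_X_pow, if_neg hl.ne', sub_zero]
    exact coeff_eq_zero_of_natDegree_lt ((h.natDegree_le i c).trans_lt hl)

theorem lower [DecidableEq κ] (h : IsPencilIsotropic A B N w) {j : κ} (hj : top N w j = 0) :
    IsPencilIsotropic A B (Function.update N j (N j - 1)) w where
  linearIndependent := h.linearIndependent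
  isotropic := h.isotropic
  degree_lt i c := by
    by_cases hij : i = j
    · subst hij
      simpa [hj] using h.degree_sub_top i c
    · simpa [hij] using h.degree_lt i c

theorem exists_top_eq_sum [Fintype κ] (h : IsPencilIsotropic A B N w) {a : κ → k} (ha : a ≠ 0) :
    ∃ w' j, IsPencilIsotropic A B N w' ∧ top N w' j = ∑ i, a i • top N w i := by
  classical
  obtain ⟨j, hj, hmax⟩ := (Finset.univ.filter fun i => a i ≠ 0).exists_max_image N (by
    obtain ⟨i, hi⟩ := Function.ne_iff.1 ha
    exact ⟨i, by simpa using hi⟩)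
  have hj : a j ≠ 0 := by simpa using hj
  have hmax (i) (hi : a i ≠ 0) : N i ≤ N j := hmax i (by simpa using hi)
  let p : κ → k[X] := fun i => C (a i) * X ^ (N j - N i)
  refine ⟨Function.update w j (∑ i, p i • w i), j,
    ⟨h.linearIndependent.update_sum_smul p (by simpa [p] using hj), fun i l => ?_,
      fun i c => ?_⟩, ?_⟩
  · simp only [Function.update_apply]
    split_ifs <;> simp [LinearMap.sum_apply, h.isotropic]
  · by_cases hij : i = j
    · subst hij
      rw [Function.update_self, Finset.sum_apply, ← mem_degreeLT]
      refine Submodule.sum_mem _ fun l _ => ?_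
      rw [mem_degreeLT]
      by_cases hl : a l = 0
      · simp [p, hl]
      refine degree_le_natDegree.trans_lt (Nat.cast_lt.2 ?_)
      have h1 := natDegree_mul_le (p := p l) (q := w l c)
      have h2 : (p l).natDegree ≤ N i - N l := natDegree_C_mul_X_pow_le _ _
      have := h.natDegree_le l c
      have := h.pos l
      have := hmax l hl
      simp only [Pi.smul_apply, smul_eq_mul]
      omega
    · simpa [hij] using h.degree_lt i c
  · funext c
    simp only [top, Function.update_self, Finset.sum_apply, finsetSum_coeff, Pi.smul_apply,
      smul_eq_mul, p]
    refine Finset.sum_congr rfl fun i _ => ?_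
    by_cases hi : a i = 0
    · simp [hi]
    have := h.pos i
    have := hmax i hi
    rw [mul_assoc, coeff_C_mul, show N j - 1 = N i - 1 + (N j - N i) by omega, coeff_X_pow_mul]

theorem exists_reflection [DecidableEq κ] (hA : A.IsSymm) (hB : B.IsSymm)
    (h : IsPencilIsotropic A B N w) {j : κ}
    (hj : A.toBilin' (top N w j) (top N w j) ≠ 0) :
    ∃ w', IsPencilIsotropic A B (Function.update N j (N j - 1)) w' := by
  set u : ι → k[X] := fun c => C (top N w j c) with hu
  set F := A.toBilin' (top N w j) (top N w j) with hF
  set H := pencilForm A B with hH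
  have hcomm : ∀ v w, H v w = H w v := pencilForm_comm hA hB
  have huu : H u u = C F := by
    rw [hH, hu, pencilForm_C, h.toBilin'_top, ← hF]
    simp
  let φ : Module.Dual k[X] (ι → k[X]) := C (2 / F) • H u
  have hφ : φ u = 2 := by
    simp only [φ, LinearMap.smul_apply, huu, smul_eq_mul, ← C_mul, div_mul_cancel₀ _ hj]
    exact map_ofNat C 2
  have hFF : C (2 / F) * C F = (2 : k[X]) := by
    rw [← C_mul, div_mul_cancel₀ _ hj]; exact map_ofNat C 2
  have hdec (i) : w i = (X ^ (N i - 1) : k[X]) • (fun c => C (top N w i c)) +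
      (fun c => w i c - X ^ (N i - 1) * C (top N w i c)) := by
    funext c; simp
  have hu1 (c) : (u c).degree < (1 : ℕ) := degree_C_le.trans_lt (by simp)
  refine ⟨fun i => Module.reflection hφ (w i), ?_, fun i l => ?_, fun i c => ?_⟩
  · exact h.linearIndependent.map' _ (LinearEquiv.ker _)
  · simp only [Module.reflection_apply, ← hH, map_sub, map_smul, LinearMap.sub_apply,
      LinearMap.smul_apply, smul_eq_mul, huu, φ]
    rw [h.isotropic, hcomm (w i) u]
    linear_combination (C (2 / F) * H u (w i) * H u (w l)) * hFF
  · rw [Module.reflection_apply, Pi.sub_apply, Pi.smul_apply, smul_eq_mul]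
    by_cases hij : i = j
    · subst hij
      rw [Function.update_self]
      set m := N i - 1
      set r : ι → k[X] := fun c => w i c - X ^ m * C (top N w i c)
      have hwi : w i = X ^ m • u + r := hdec i
      have hrd (c) : (r c).degree < m := h.degree_sub_top i c
      have h0 : X ^ m * (X ^ m * C F + 2 * H u r) = - H r r := by
        have := h.isotropic i i
        rw [← hH, hwi] at this
        simp only [map_add, map_smul, LinearMap.add_apply, LinearMap.smul_apply, smul_eq_mul,
          huu, hcomm r u] at this
        linear_combination this
      have h1 : (X ^ m * C F + 2 * H u r).degree < (m : WithBot ℕ) := by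
        have h2 : (X ^ m * (X ^ m * C F + 2 * H u r)).degree < ((m + m : ℕ) : WithBot ℕ) := by
          rw [h0, degree_neg]
          exact degree_pencilForm_lt hrd hrd
        rw [degree_mul, degree_X_pow, Nat.cast_add] at h2
        exact lt_of_add_lt_add_left h2
      have h2 : w i c - φ (w i) * u c =
          r c - (C (F⁻¹ * top N w i c)) * (X ^ m * C F + 2 * H u r) := by
        have hinv : C F⁻¹ * C F = (1 : k[X]) := by rw [← C_mul, inv_mul_cancel₀ hj, C_1]
        have h2F : C (2 / F) = 2 * C F⁻¹ := by rw [div_eq_mul_inv, C_mul, map_ofNat C 2]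
        rw [hwi]
        simp only [φ, map_add, map_smul, LinearMap.smul_apply, smul_eq_mul, huu, Pi.add_apply,
          Pi.smul_apply, h2F, C_mul, show u c = C (top N w i c) from rfl]
        linear_combination (-(X ^ m * C (top N w i c))) * hinv
      rw [h2, ← mem_degreeLT]
      refine Submodule.sub_mem _ (mem_degreeLT.2 (hrd c)) ?_
      rw [← smul_eq_C_mul]
      exact Submodule.smul_mem _ _ (mem_degreeLT.2 h1)
    · rw [Function.update_of_ne hij]
      have hpos := h.pos i
      have h1 : (H u (w i)).degree < N i := by
        rw [hdec i, map_add, map_smul, hH, hu, pencilForm_C, h.toBilin'_top, ← mem_degreeLT]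
        refine Submodule.add_mem _ (mem_degreeLT.2 ?_) (mem_degreeLT.2 ?_)
        · rw [C_0, mul_zero, add_zero, smul_eq_mul, mul_comm]
          exact (degree_C_mul_X_pow_le _ _).trans_lt (Nat.cast_lt.2 (by omega))
        · refine (degree_pencilForm_lt hu1 (h.degree_sub_top i)).trans_eq ?_
          congr 1; omega
      have h2 : φ (w i) * u c = (2 / F * top N w j c) • H u (w i) := by
        simp only [φ, LinearMap.smul_apply, smul_eq_mul, hu, smul_eq_C_mul, C_mul]
        ring
      rw [h2, ← mem_degreeLT]
      exact Submodule.sub_mem _ (mem_degreeLT.2 (h.degree_lt i c))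
        (Submodule.smul_mem _ _ (mem_degreeLT.2 h1))

theorem exists_common_isotropic [Fintype κ] (hA : A.IsSymm) (hB : B.IsSymm)
    (h : IsPencilIsotropic A B N w) : ∃ u : κ → ι → k, LinearIndependent k u ∧
      ∀ v ∈ Submodule.span k (Set.range u), A.toBilin' v v = 0 ∧ B.toBilin' v v = 0 := by
  classical
  induction hs : ∑ i, N i using Nat.strong_induction_on generalizing N w with
  | _ s ih =>
  subst hs
  have hlt (j : κ) : ∑ i, Function.update N j (N j - 1) i < ∑ i, N i := by
    refine Finset.sum_lt_sum (fun i _ => ?_) ⟨j, Finset.mem_univ j, ?_⟩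
    · rw [Function.update_apply]
      split_ifs with hij
      · subst hij; omega
      · rfl
    · have := h.pos j
      rw [Function.update_self]; omega
  by_cases hli : LinearIndependent k (top N w)
  · by_cases hf : ∀ a : κ → k, A.toBilin' (∑ i, a i • top N w i) (∑ i, a i • top N w i) = 0
    · refine ⟨_, hli, fun v hv => ?_⟩
      obtain ⟨a, rfl⟩ := (Submodule.mem_span_range_iff_exists_fun k).1 hv
      exact ⟨hf a, by simp [LinearMap.sum_apply, h.toBilin'_top]⟩
    · push Not at hf
      obtain ⟨a, ha⟩ := hf
      obtain ⟨w', j, hw', hj⟩ := h.exists_top_eq_sum (a := a) (by rintro rfl; simp at ha)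
      rw [← hj] at ha
      obtain ⟨w'', hw''⟩ := hw'.exists_reflection hA hB ha
      exact ih _ (hlt j) hw'' rfl
  · rw [Fintype.linearIndependent_iff] at hli
    push Not at hli
    obtain ⟨a, ha0, i, hi⟩ := hli
    obtain ⟨w', j, hw', hj⟩ := h.exists_top_eq_sum (a := a) (by rintro rfl; simp at hi)
    exact ih _ (hlt j) (hw'.lower (hj.trans ha0)) rfl

end IsPencilIsotropic

end Matrix

namespace QuadraticForm

theorem piScalarRight_symm_algebraMap_comp (K : Type*) [Field K] [Algebra k K] {n : ℕ}
    (v : Fin n → k) :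
    (TensorProduct.piScalarRight k K K (Fin n)).symm (algebraMap k K ∘ v) = 1 ⊗ₜ[k] v := by
  rw [LinearEquiv.symm_apply_eq]
  funext c
  simp [Algebra.smul_def]

theorem baseChangePi_sum_smul {K : Type*} [Field K] [Algebra k K] (h2 : (2 : k) ≠ 0)
    [inv : Invertible (2 : k)] [Fintype κ] {n : ℕ} (Q : QuadraticForm k (Fin n → k)) (a : κ → K)
    (v : κ → Fin n → k) :
    Q.baseChangePi K h2 (∑ i, a i • (algebraMap k K ∘ v i)) =
      ∑ i, ∑ j, a i * algebraMap k K (QuadraticMap.associated (R := k) Q (v i) (v j)) * a j := by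
  have : Invertible (2 : K) := invertibleOfNonzero <| by
    rw [← map_ofNat (algebraMap k K) 2]
    exact (_root_.map_ne_zero _).2 h2
  obtain rfl : inv = invertibleOfNonzero h2 := Subsingleton.elim _ _
  let _ : Invertible (2 : k) := invertibleOfNonzero h2
  change Q.baseChange K ((TensorProduct.piScalarRight k K K (Fin n)).symm _) = _
  rw [← QuadraticMap.associated_eq_self_apply K, QuadraticForm.associated_baseChange]
  simp only [map_sum, map_smul, LinearMap.sum_apply, LinearMap.smul_apply,
    piScalarRight_symm_algebraMap_comp, LinearMap.BilinForm.baseChange_tmul]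
  rw [Finset.sum_comm]
  refine Finset.sum_congr rfl fun i _ => ?_
  rw [Finset.smul_sum]
  refine Finset.sum_congr rfl fun j _ => ?_
  simp only [Algebra.smul_def, mul_one, Algebra.algebraMap_self, RingHom.id_apply]
  ring

theorem baseChangePi_apply_s1 {K : Type*} [Field K] [Algebra k K] (h2 : (2 : k) ≠ 0)
    [Invertible (2 : k)] {n : ℕ} (Q : QuadraticForm k (Fin n → k)) (v : Fin n → K) :
    Q.baseChangePi K h2 v = ∑ i, ∑ j, v i * algebraMap k K (Q.toMatrix' i j) * v j := by
  have hv : v = ∑ i, v i • (algebraMap k K ∘ Pi.single i 1) := by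
    funext c
    simp [Pi.single_apply]
  conv_lhs => rw [hv, baseChangePi_sum_smul]
  simp only [toMatrix', LinearMap.toMatrix₂'_apply]

theorem toBilin'_toMatrix'_self {n : ℕ} [Invertible (2 : k)]
    (Q : QuadraticForm k (Fin n → k)) (v : Fin n → k) : Q.toMatrix'.toBilin' v v = Q v := by
  rw [QuadraticForm.toMatrix']
  exact (LinearMap.congr_fun₂ (Matrix.toBilin'_toMatrix' Q.associated) v v).trans
    (QuadraticMap.associated_eq_self_apply k Q v)

theorem algebraMap_pencilForm_self (h2 : (2 : k) ≠ 0) [Invertible (2 : k)] {n : ℕ}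
    (f g : QuadraticForm k (Fin n → k)) (v : Fin n → k[X]) :
    algebraMap k[X] (RatFunc k) (Matrix.pencilForm f.toMatrix' g.toMatrix' v v) =
      (f.baseChangePi (RatFunc k) h2 + (RatFunc.X : RatFunc k) • g.baseChangePi (RatFunc k) h2)
        (algebraMap k[X] (RatFunc k) ∘ v) := by
  simp only [add_apply, smul_apply, baseChangePi_apply_s1,
    Matrix.pencilForm_apply, map_sum, map_mul, map_add, smul_eq_mul, Finset.mul_sum,
    ← Finset.sum_add_distrib, RatFunc.algebraMap_X, Function.comp_apply, RatFunc.algebraMap_C,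
    RatFunc.algebraMap_eq_C]
  refine Finset.sum_congr rfl fun i _ => Finset.sum_congr rfl fun j _ => ?_
  ring

theorem pencilForm_eq_zero (h2 : (2 : k) ≠ 0) [Invertible (2 : k)] {n : ℕ}
    (f g : QuadraticForm k (Fin n → k)) {W : Submodule (RatFunc k) (Fin n → RatFunc k)}
    (hW : ∀ w ∈ W, (f.baseChangePi (RatFunc k) h2 +
      (RatFunc.X : RatFunc k) • g.baseChangePi (RatFunc k) h2) w = 0) {v w : Fin n → k[X]}
    (hv : algebraMap k[X] (RatFunc k) ∘ v ∈ W) (hw : algebraMap k[X] (RatFunc k) ∘ w ∈ W) :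
    Matrix.pencilForm f.toMatrix' g.toMatrix' v w = 0 := by
  have hself {u : Fin n → k[X]} (hu : algebraMap k[X] (RatFunc k) ∘ u ∈ W) :
      Matrix.pencilForm f.toMatrix' g.toMatrix' u u = 0 := by
    apply RatFunc.algebraMap_injective k
    rw [algebraMap_pencilForm_self h2, hW _ hu, map_zero]
  have hadd : algebraMap k[X] (RatFunc k) ∘ (v + w) ∈ W := by
    have : algebraMap k[X] (RatFunc k) ∘ (v + w) =
        algebraMap k[X] (RatFunc k) ∘ v + algebraMap k[X] (RatFunc k) ∘ w := by
      funext c; simp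
    rw [this]
    exact W.add_mem hv hw
  have h := hself hadd
  simp only [map_add, LinearMap.add_apply, hself hv, hself hw, zero_add, add_zero,
    Matrix.pencilForm_comm (isSymm_toMatrix' f) (isSymm_toMatrix' g) w v, ← two_mul] at h
  have h2' : (2 : k[X]) ≠ 0 := by
    rw [← map_ofNat C 2]
    exact C_ne_zero.2 h2
  exact (mul_eq_zero.1 h).resolve_left h2'

end QuadraticForm

/-- Clearing denominators in a linearly independent family over the field of fractions. -/
theorem LinearIndependent.exists_clear_denominators {R K α : Type*} [CommRing R] [IsDomain R]
    [Field K] [Algebra R K] [IsFractionRing R K] [Finite κ] [Finite α]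
    {b : κ → α → K}
    (hb : LinearIndependent K b) : ∃ (s : K) (w : κ → α → R), LinearIndependent R w ∧
      ∀ i, algebraMap R K ∘ w i = s • b i := by
  obtain ⟨s, hs⟩ := IsLocalization.exist_integer_multiples_of_finite (nonZeroDivisors R)
    (fun p : κ × α => b p.1 p.2)
  choose w hw using hs
  have hsb (i : κ) : (algebraMap R K ∘ fun c => w (i, c)) = algebraMap R K s • b i := by
    funext c
    simpa [Algebra.smul_def] using hw (i, c)
  refine ⟨algebraMap R K s, fun i c => w (i, c), ?_, hsb⟩
  have hs0 : algebraMap R K s ≠ 0 := IsFractionRing.to_map_ne_zero_of_mem_nonZeroDivisors s.2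
  have hli : LinearIndependent K fun i => algebraMap R K s • b i :=
    hb.units_smul fun _ => Units.mk0 _ hs0
  refine LinearIndependent.of_comp ((Algebra.linearMap R K).compLeft α) ?_
  rw [LinearIndependent.iff_fractionRing R K]
  have hw' : (Algebra.linearMap R K).compLeft α ∘ (fun i c => w (i, c)) =
      fun i => algebraMap R K s • b i := funext hsb
  rwa [hw']

end Amer

/-- **Amer's theorem**: the pencil `f + t g` over `k(t)` vanishes on a `d`-dimensional
subspace if and only if `f` and `g` have a common `d`-dimensional totally isotropic
subspace over `k`. -/
theorem amer_theorem {n : ℕ} {k : Type*} [Field k] (h2 : (2 : k) ≠ 0)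
    (f g : QuadraticForm k (Fin (n + 1) → k)) (d : ℕ) (hd : 1 ≤ d) :
    (∃ W : Submodule (RatFunc k) (Fin (n + 1) → RatFunc k),
        Module.finrank (RatFunc k) W = d ∧
        ∀ w ∈ W,
          (f.baseChangePi (RatFunc k) h2 + (RatFunc.X : RatFunc k) •
            g.baseChangePi (RatFunc k) h2) w = 0) ↔
    (∃ V : Submodule k (Fin (n + 1) → k),
        Module.finrank k V = d ∧ ∀ v ∈ V, f v = 0 ∧ g v = 0) := by
  let _ : Invertible (2 : k) := invertibleOfNonzero h2
  constructor
  · rintro ⟨W, hWd, hW⟩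
    let b := Module.finBasisOfFinrankEq (RatFunc k) W hWd
    obtain ⟨s, w, hwli, hw⟩ := (b.linearIndependent.map' W.subtype
      W.ker_subtype).exists_clear_denominators (R := k[X])
    have hwW (i) : algebraMap k[X] (RatFunc k) ∘ w i ∈ W := by
      rw [hw]
      exact W.smul_mem _ (b i).2
    have h : Matrix.IsPencilIsotropic f.toMatrix' g.toMatrix'
        (fun i => ∑ c, (w i c).natDegree + 1) w :=
      ⟨hwli, fun i j => QuadraticForm.pencilForm_eq_zero h2 f g hW (hwW i) (hwW j),
        fun i c => degree_le_natDegree.trans_lt <| Nat.cast_lt.2 <| Nat.lt_succ_of_le <|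
          Finset.single_le_sum (f := fun c => (w i c).natDegree)
            (fun _ _ => Nat.zero_le _) (Finset.mem_univ c)⟩
    obtain ⟨u, hu, huV⟩ := h.exists_common_isotropic (QuadraticForm.isSymm_toMatrix' f)
      (QuadraticForm.isSymm_toMatrix' g)
    refine ⟨Submodule.span k (Set.range u), by simp [finrank_span_eq_card hu], fun v hv => ?_⟩
    simpa only [QuadraticForm.toBilin'_toMatrix'_self] using huV v hv
  · rintro ⟨V, hVd, hV⟩
    let b := Module.finBasisOfFinrankEq k V hVd
    have hli : LinearIndependent (RatFunc k)
        fun i => algebraMap k (RatFunc k) ∘ (b i : Fin (n + 1) → k) := by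
      have h := (Module.Flat.linearIndependent_one_tmul (S := RatFunc k)
        (b.linearIndependent.map' V.subtype V.ker_subtype)).map'
        (TensorProduct.piScalarRight k (RatFunc k) (RatFunc k) (Fin (n + 1))).toLinearMap
        (LinearEquiv.ker _)
      have heq : (fun i => algebraMap k (RatFunc k) ∘ (b i : Fin (n + 1) → k)) = _ :=
        funext fun i => (LinearEquiv.symm_apply_eq _).1
          (QuadraticForm.piScalarRight_symm_algebraMap_comp (RatFunc k) (b i : Fin (n + 1) → k))
      rw [heq]
      exact h
    have hassoc (Q : QuadraticForm k (Fin (n + 1) → k)) (hQ : ∀ v ∈ V, Q v = 0) (i j) :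
        QuadraticMap.associated (R := k) Q (b i) (b j) = 0 := by
      rw [QuadraticMap.associated_apply, hQ _ (V.add_mem (b i).2 (b j).2), hQ _ (b i).2,
        hQ _ (b j).2]
      simp
    refine ⟨Submodule.span (RatFunc k) (Set.range _), (finrank_span_eq_card hli).trans (by simp),
      fun v hv => ?_⟩
    obtain ⟨a, rfl⟩ := (Submodule.mem_span_range_iff_exists_fun _).1 hv
    rw [add_apply, smul_apply, QuadraticForm.baseChangePi_sum_smul,
      QuadraticForm.baseChangePi_sum_smul]
    simp [hassoc f fun v hv => (hV v hv).1, hassoc g fun v hv => (hV v hv).2]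
end

section
/- (Brumer's theorem) Let k be a field of characteristic different from 2 and let f and g be quadratic forms on k^{n+1}. Let K = k(t) be the field of rational functions in one variable and consider the quadratic form h = f_K + t·g_K on K^{n+1}, where f_K and g_K are the base changes of f and g to K. Then h is isotropic over K (i.e., h(w) = 0 for some nonzero w in K^{n+1}) if and only if f and g have a common nontrivial zero over k (i.e., there exists a nonzero v in k^{n+1} with f(v) = 0 and g(v) = 0). -/
open Polynomial in
theorem Polynomial.coeff_mul_eq_zero_of_coeff_eq_zero {R : Type*} [CommRing R] {p q : R[X]}
    {d e n : ℕ} (hp : ∀ i, d ≤ i → p.coeff i = 0) (hq : ∀ i, e ≤ i → q.coeff i = 0)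
    (h : d + e ≤ n + 1) : (p * q).coeff n = 0 := by
  rw [coeff_mul]
  refine Finset.sum_eq_zero fun x hx => ?_
  rw [Finset.HasAntidiagonal.mem_antidiagonal] at hx
  by_cases h1 : d ≤ x.1
  · rw [hp _ h1, zero_mul]
  · rw [hq _ (by omega), mul_zero]

open Polynomial in
theorem Polynomial.coeff_X_mul_eq_zero {R : Type*} [CommRing R] {p : R[X]} {n : ℕ}
    (h : ∀ i, n ≤ i + 1 → p.coeff i = 0) : (X * p).coeff n = 0 := by
  cases n with
  | zero => simp
  | succ n => rw [coeff_X_mul]; exact h n le_rfl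

open Polynomial in
theorem Matrix.coeff_toBilin'_map_C_eq_zero {R : Type*} [CommRing R] {ι : Type*} [Fintype ι]
    [DecidableEq ι] (A : Matrix ι ι R) {p q : ι → R[X]} {d e n : ℕ}
    (hp : ∀ j i, d ≤ i → (p j).coeff i = 0) (hq : ∀ j i, e ≤ i → (q j).coeff i = 0)
    (h : d + e ≤ n + 1) : (Matrix.toBilin' (A.map C) p q).coeff n = 0 := by
  rw [Matrix.toBilin'_apply, finsetSum_coeff]
  refine Finset.sum_eq_zero fun i _ => ?_
  rw [finsetSum_coeff]
  refine Finset.sum_eq_zero fun j _ => ?_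
  rw [Matrix.map_apply, mul_comm (p i), mul_assoc, coeff_C_mul,
    coeff_mul_eq_zero_of_coeff_eq_zero (hp i) (hq j) h, mul_zero]

theorem Matrix.toBilin'_map_comp {R S : Type*} [CommRing R] [CommRing S] {ι : Type*} [Fintype ι]
    [DecidableEq ι] (φ : R →+* S) (A : Matrix ι ι R) (v w : ι → R) :
    Matrix.toBilin' (A.map φ) (fun i => φ (v i)) (fun i => φ (w i)) =
      φ (Matrix.toBilin' A v w) := by
  simp [Matrix.toBilin'_apply]

/-- Reflecting an isotropic vector `p` in an anisotropic vector `v` gives an isotropic vector. -/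
theorem LinearMap.BilinForm.exists_isotropic_sub_smul {R M : Type*} [CommRing R] [IsDomain R]
    [AddCommGroup M] [Module R M] (H : LinearMap.BilinForm R M) (hH : ∀ x y, H x y = H y x)
    {v p : M} {c : R} (hc : c * H v v = 1) (hp : H p p = 0) (hp0 : p ≠ 0) :
    p - (c * (2 * H v p)) • v ≠ 0 ∧
      H (p - (c * (2 * H v p)) • v) (p - (c * (2 * H v p)) • v) = 0 := by
  set l := c * (2 * H v p) with hl
  constructor
  · intro h
    rw [sub_eq_zero] at h
    have hv : l * l = 0 := by
      have h1 : H (l • v) (l • v) = 0 := by rw [← h, hp]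
      simp only [map_smul, LinearMap.smul_apply, smul_eq_mul] at h1
      linear_combination c * h1 - l * l * hc
    exact hp0 (by rw [h, mul_self_eq_zero.mp hv, zero_smul])
  · simp only [map_sub, map_smul, LinearMap.sub_apply, LinearMap.smul_apply, smul_eq_mul, hp,
      hH p v]
    linear_combination (l * 2 * H v p) * hc + l * H v v * hl

open Polynomial in
/-- The pencil `A + X B` of bilinear forms over `R[X]`. -/
noncomputable def Matrix.pencilBilin {R : Type*} [CommRing R] {ι : Type*} [Fintype ι]
    [DecidableEq ι] (A B : Matrix ι ι R) : LinearMap.BilinForm R[X] (ι → R[X]) :=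
  Matrix.toBilin' (A.map C) + (X : R[X]) • Matrix.toBilin' (B.map C)

open Polynomial in
theorem Matrix.pencilBilin_apply {R : Type*} [CommRing R] {ι : Type*} [Fintype ι]
    [DecidableEq ι] (A B : Matrix ι ι R) (p q : ι → R[X]) :
    A.pencilBilin B p q = Matrix.toBilin' (A.map C) p q + X * Matrix.toBilin' (B.map C) p q := rfl

theorem Matrix.IsSymm.toBilin'_comm {R : Type*} [CommRing R] {ι : Type*} [Fintype ι]
    [DecidableEq ι] {A : Matrix ι ι R} (hA : A.IsSymm) (p q : ι → R) :
    Matrix.toBilin' A p q = Matrix.toBilin' A q p := by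
  simp only [Matrix.toBilin'_apply]
  rw [Finset.sum_comm]
  refine Finset.sum_congr rfl fun i _ => Finset.sum_congr rfl fun j _ => ?_
  rw [hA.apply]
  ring

open Polynomial in
theorem Matrix.exists_common_zero_of_pencilBilin {k : Type*} [Field k] {ι : Type*} [Fintype ι]
    [DecidableEq ι] {A B : Matrix ι ι k} (hA : A.IsSymm) (hB : B.IsSymm) (d : ℕ) :
    ∀ p : ι → k[X], (∀ j i, d ≤ i → (p j).coeff i = 0) → p ≠ 0 → A.pencilBilin B p p = 0 →
      ∃ v : ι → k, v ≠ 0 ∧ Matrix.toBilin' A v v = 0 ∧ Matrix.toBilin' B v v = 0 := by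
  induction d with
  | zero =>
    intro p hd hp0 _
    exact absurd (_root_.funext fun j => Polynomial.ext fun i => by simpa using hd j i i.zero_le) hp0
  | succ d ih =>
    intro p hd hp0 hp
    set v : ι → k := fun j => (p j).coeff d with hv
    by_cases hv0 : v = 0
    · refine ih p (fun j i hi => ?_) hp0 hp
      rcases hi.eq_or_lt with rfl | hi
      · exact congrFun hv0 j
      · exact hd j i hi
    set V : ι → k[X] := fun j => C (v j) with hV
    set u : ι → k[X] := p - (X ^ d : k[X]) • V with hu
    have hpu : p = (X ^ d : k[X]) • V + u := by rw [hu]; abel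
    have hVd : ∀ j i, 1 ≤ i → (V j).coeff i = 0 := fun j i hi => by
      rw [hV, coeff_C_of_ne_zero (by omega)]
    have hud : ∀ j i, d ≤ i → (u j).coeff i = 0 := fun j i hi => by
      rcases hi.eq_or_lt with rfl | hi
      · simp [hu, hV, hv]
      · simp [hu, hV, hd j i hi, hi.ne']
    have hAs : (A.map (C : k →+* k[X])).IsSymm := hA.map _
    have hBs : (B.map (C : k →+* k[X])).IsSymm := hB.map _
    have hH : ∀ x y, A.pencilBilin B x y = A.pencilBilin B y x := fun x y => by
      rw [pencilBilin_apply, pencilBilin_apply, hAs.toBilin'_comm, hBs.toBilin'_comm]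
    have hAV : Matrix.toBilin' (A.map C) V V = C (Matrix.toBilin' A v v) :=
      toBilin'_map_comp C A v v
    have hBV : Matrix.toBilin' (B.map C) V V = C (Matrix.toBilin' B v v) :=
      toBilin'_map_comp C B v v
    have hVV : A.pencilBilin B V V =
        C (Matrix.toBilin' A v v) + X * C (Matrix.toBilin' B v v) := by
      rw [pencilBilin_apply, hAV, hBV]
    have hexp : A.pencilBilin B p p = C (Matrix.toBilin' A v v) * X ^ (2 * d) +
        C (Matrix.toBilin' B v v) * X ^ (2 * d + 1) +
        C 2 * (A.pencilBilin B V u * X ^ d) + A.pencilBilin B u u := by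
      rw [hpu]
      simp only [map_add, map_smul, LinearMap.add_apply, LinearMap.smul_apply, smul_eq_mul, hVV,
        hH u V, map_ofNat]
      ring
    have hVu : ∀ i, d + 1 ≤ i → (A.pencilBilin B V u).coeff i = 0 := fun i hi => by
      rw [pencilBilin_apply, coeff_add, coeff_toBilin'_map_C_eq_zero A hVd hud (by omega),
        coeff_X_mul_eq_zero fun m hm => coeff_toBilin'_map_C_eq_zero B hVd hud (by omega), add_zero]
    have huu : ∀ i, 2 * d ≤ i → (A.pencilBilin B u u).coeff i = 0 := fun i hi => by
      rw [pencilBilin_apply, coeff_add, coeff_toBilin'_map_C_eq_zero A hud hud (by omega),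
        coeff_X_mul_eq_zero fun m hm => coeff_toBilin'_map_C_eq_zero B hud hud (by omega), add_zero]
    rw [hp] at hexp
    have hB0 : Matrix.toBilin' B v v = 0 := by
      have h := congrArg (coeff · (2 * d + 1)) hexp
      simp only [coeff_add, coeff_C_mul, coeff_zero, coeff_mul_X_pow'] at h
      rw [huu _ (by omega), hVu _ (by omega)] at h
      simpa using h.symm
    by_cases hA0 : Matrix.toBilin' A v v = 0
    · exact ⟨v, hv0, hA0, hB0⟩
    set c := Matrix.toBilin' A v v with hc
    rw [hB0, C_0, mul_zero, add_zero] at hVV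
    have hcoeff : c + 2 * (A.pencilBilin B V u).coeff d = 0 := by
      have h := congrArg (coeff · (2 * d)) hexp
      simp only [coeff_add, coeff_C_mul, coeff_zero, coeff_mul_X_pow'] at h
      rw [huu _ le_rfl, if_pos le_rfl, if_pos (by omega : d ≤ 2 * d),
        show 2 * d - d = d by omega] at h
      simpa [hB0] using h.symm
    obtain ⟨h1, h2⟩ := LinearMap.BilinForm.exists_isotropic_sub_smul (A.pencilBilin B) hH
      (v := V) (c := C c⁻¹) (by rw [hVV, ← C_mul, inv_mul_cancel₀ hA0, C_1]) hp hp0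
    refine ih _ (fun j i hi => ?_) h1 h2
    have hVp : A.pencilBilin B V p = C c * X ^ d + A.pencilBilin B V u := by
      rw [hpu, map_add, map_smul, hVV, smul_eq_mul, mul_comm]
    have hl : (C c⁻¹ * (2 * A.pencilBilin B V p)).coeff i = if i = d then 1 else 0 := by
      rw [hVp, ← C_ofNat, coeff_C_mul, coeff_C_mul, coeff_add, coeff_C_mul, coeff_X_pow]
      split_ifs with hid
      · subst hid
        field_simp
        linear_combination hcoeff
      · rw [hVu i (by omega)]
        ring
    rw [Pi.sub_apply, Pi.smul_apply, smul_eq_mul, coeff_sub, hV, coeff_mul_C, hl]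
    split_ifs with hid
    · simp [hv, hid]
    · simp [hd j i (by omega)]

theorem QuadraticForm.exists_isSymm_baseChangePi_apply {k : Type*} [Field k] (K : Type*)
    [Field K] [Algebra k K] (h2 : (2 : k) ≠ 0) {n : ℕ} (Q : QuadraticForm k (Fin n → k)) :
    ∃ A : Matrix (Fin n) (Fin n) k, A.IsSymm ∧ (∀ v, Q v = Matrix.toBilin' A v v) ∧
      ∀ w : Fin n → K, Q.baseChangePi K h2 w = Matrix.toBilin' (A.map (algebraMap k K)) w w := by
  let _ : Invertible (2 : k) := invertibleOfNonzero h2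
  refine ⟨LinearMap.BilinForm.toMatrix' (QuadraticMap.associated (R := k) Q), ?_, fun v => ?_, ?_⟩
  · ext i j
    simp only [Matrix.transpose_apply, LinearMap.BilinForm.toMatrix'_apply]
    exact QuadraticMap.associated_isSymm k Q _ _
  · rw [Matrix.toBilin'_toMatrix', QuadraticMap.associated_eq_self_apply]
  · intro w
    let _ : Invertible (2 : K) := (Invertible.map (algebraMap k K) 2).copy 2 (map_ofNat _ 2).symm
    have key : (LinearMap.BilinForm.baseChange K (QuadraticMap.associated (R := k) Q)).comp
        (TensorProduct.piScalarRight k K K (Fin n)).symm.toLinearMap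
        (TensorProduct.piScalarRight k K K (Fin n)).symm.toLinearMap =
        Matrix.toBilin' ((LinearMap.BilinForm.toMatrix'
          (QuadraticMap.associated (R := k) Q)).map (algebraMap k K)) := by
      refine LinearMap.BilinForm.ext_basis (Pi.basisFun K (Fin n)) fun i j => ?_
      simp [Matrix.toBilin'_single, Algebra.algebraMap_eq_smul_one]
    rw [← key, LinearMap.BilinForm.comp_apply, ← QuadraticForm.associated_baseChange,
      QuadraticMap.associated_eq_self_apply]
    rfl

/-- **Brumer's theorem**: the quadratic form `f + t g` over `K = k(t)` is isotropic
if and only if `f` and `g` have a common nontrivial zero over `k`. -/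
theorem brumer_theorem {n : ℕ} {k : Type*} [Field k] (h2 : (2 : k) ≠ 0)
    (f g : QuadraticForm k (Fin (n + 1) → k)) :
    (∃ w : Fin (n + 1) → RatFunc k, w ≠ 0 ∧
        (f.baseChangePi (RatFunc k) h2 + (RatFunc.X : RatFunc k) •
          g.baseChangePi (RatFunc k) h2) w = 0) ↔
    (∃ v : Fin (n + 1) → k, v ≠ 0 ∧ f v = 0 ∧ g v = 0) := by
  obtain ⟨A, hA, hfA, hfK⟩ := f.exists_isSymm_baseChangePi_apply (RatFunc k) h2
  obtain ⟨B, hB, hgB, hgK⟩ := g.exists_isSymm_baseChangePi_apply (RatFunc k) h2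
  simp only [add_apply, smul_apply, smul_eq_mul, hfA, hgB, hfK, hgK]
  constructor
  · rintro ⟨w, hw0, hw⟩
    obtain ⟨b, hb⟩ := IsLocalization.exist_integer_multiples_of_finite
      (nonZeroDivisors (Polynomial k)) w
    choose p hp using hb
    have hb0 : algebraMap (Polynomial k) (RatFunc k) b ≠ 0 := by
      simp
    have hpw : (fun i => algebraMap (Polynomial k) (RatFunc k) (p i)) =
        algebraMap (Polynomial k) (RatFunc k) b • w := by
      funext i
      rw [hp i, Pi.smul_apply, Algebra.smul_def, smul_eq_mul]
    have hmap : ∀ M : Matrix (Fin (n + 1)) (Fin (n + 1)) k, M.map (algebraMap k (RatFunc k)) =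
        (M.map Polynomial.C).map (algebraMap (Polynomial k) (RatFunc k)) := fun M => by
      ext i j
      simp
    refine Matrix.exists_common_zero_of_pencilBilin hA hB
      ((Finset.univ.sup fun j => (p j).natDegree) + 1) p (fun j i hi => ?_) (fun h => ?_) ?_
    · refine Polynomial.coeff_eq_zero_of_natDegree_lt (lt_of_lt_of_le (Nat.lt_succ_of_le ?_) hi)
      exact Finset.le_sup (f := fun j => (p j).natDegree) (Finset.mem_univ j)
    · subst h
      refine hw0 ((smul_eq_zero.mp (hpw.symm.trans ?_)).resolve_left hb0)
      funext i
      simp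
    · apply IsFractionRing.injective (Polynomial k) (RatFunc k)
      rw [Matrix.pencilBilin_apply, map_add, map_mul, ← Matrix.toBilin'_map_comp,
        ← Matrix.toBilin'_map_comp, hpw, RatFunc.algebraMap_X, map_zero, ← hmap, ← hmap]
      simp only [map_smul, LinearMap.smul_apply, smul_eq_mul]
      linear_combination (algebraMap (Polynomial k) (RatFunc k) b) ^ 2 * hw
  · rintro ⟨v, hv0, hAv, hBv⟩
    refine ⟨fun i => algebraMap k (RatFunc k) (v i), fun h => hv0 (funext fun i => ?_), ?_⟩
    · exact (map_eq_zero (algebraMap k (RatFunc k))).mp (congrFun h i)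
    · rw [Matrix.toBilin'_map_comp, Matrix.toBilin'_map_comp, hAv, hBv, map_zero, mul_zero,
        add_zero]
end

section
/- Let k be a field of characteristic different from 2, let m ≥ 1, and let c ∈ k be nonzero. Consider the split quadratic form q of odd rank on k^{2m+1} given by q(x) = Σ_{i=0}^{m-1} x_i · x_{m+i} + c · x_{2m}². Then: (a) there exists an m-dimensional k-subspace of k^{2m+1} on which q vanishes identically; and (b) every k-subspace of k^{2m+1} on which q vanishes identically has dimension at most m. -/
/-- A totally isotropic subspace for a quadratic form with left-separating polar form has
dimension at most half that of the whole space. -/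
theorem QuadraticForm.two_mul_finrank_le_of_isotropic {K V : Type*} [Field K] [AddCommGroup V]
    [Module K V] [FiniteDimensional K V] (Q : QuadraticForm K V)
    (hQ : LinearMap.SeparatingLeft Q.polarBilin) (W : Submodule K V) (hW : ∀ w ∈ W, Q w = 0) :
    2 * Module.finrank K W ≤ Module.finrank K V := by
  have hker : LinearMap.ker Q.polarBilin = ⊥ := LinearMap.separatingLeft_iff_ker_eq_bot.mp hQ
  have hle : W ≤ LinearMap.BilinForm.orthogonal Q.polarBilin W := by
    intro x hx y hy
    simp [QuadraticMap.polar, hW _ hx, hW _ hy,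
      hW _ (W.add_mem hy hx)]
  have hdim := LinearMap.BilinForm.finrank_add_finrank_orthogonal' (B := Q.polarBilin) W
  rw [hker, inf_bot_eq, finrank_bot] at hdim
  have := Submodule.finrank_mono hle
  omega

/-- The polar form of a sum of hyperbolic planes and a line. -/
theorem QuadraticForm.polar_of_hyperbolic_add_sq {k ι η : Type*} [Field k] [Fintype η]
    (a b : η → ι) (o : ι) (c : k) (q : QuadraticForm k (ι → k))
    (hq : ∀ x, q x = ∑ i, x (a i) * x (b i) + c * x o ^ 2) (x y : ι → k) :
    QuadraticMap.polar q x y =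
      ∑ i, (x (a i) * y (b i) + x (b i) * y (a i)) + 2 * c * (x o * y o) := by
  rw [QuadraticMap.polar, hq, hq, hq]
  simp only [Pi.add_apply, add_mul, mul_add, Finset.sum_add_distrib]
  simp only [mul_comm (y (a _)) (x (b _))]
  ring

/-- In characteristic not two, an orthogonal sum of hyperbolic planes and a line on which the form
is nonzero has left-separating polar form. -/
theorem QuadraticForm.separatingLeft_polarBilin_of_hyperbolic_add_sq {k ι η : Type*} [Field k]
    [Fintype η] (h2 : (2 : k) ≠ 0) {a b : η → ι} {o : ι} (ha : Function.Injective a)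
    (hb : Function.Injective b) (hab : ∀ i j, a i ≠ b j) (hao : ∀ i, a i ≠ o)
    (hbo : ∀ i, b i ≠ o) (hcover : ∀ j, (∃ i, a i = j) ∨ (∃ i, b i = j) ∨ o = j)
    {c : k} (hc : c ≠ 0) (q : QuadraticForm k (ι → k))
    (hq : ∀ x, q x = ∑ i, x (a i) * x (b i) + c * x o ^ 2) :
    LinearMap.SeparatingLeft q.polarBilin := by
  classical
  intro x hx
  have hpolar (y : ι → k) := (q.polar_of_hyperbolic_add_sq a b o c hq x y).symm.trans (hx y)
  funext j
  rcases hcover j with ⟨i, rfl⟩ | ⟨i, rfl⟩ | rfl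
  · simpa [Pi.single_apply, hb.eq_iff, hab, (hbo i).symm] using hpolar (Pi.single (b i) 1)
  · simpa [Pi.single_apply, ha.eq_iff, fun i j => (hab i j).symm, (hao i).symm]
      using hpolar (Pi.single (a i) 1)
  · simpa [Pi.single_apply, hao, hbo, h2, hc] using hpolar (Pi.single o 1)


/-- The split quadratic form `q(x) = Σ_{i<m} x_i · x_{m+i} + c·x_{2m}²` of odd rank on
`k^{2m+1}` (with `c ≠ 0`) admits an `m`-dimensional totally isotropic subspace, and every
totally isotropic subspace has dimension at most `m`. -/
theorem split_odd_rank_form_max_isotropic {k : Type*} [Field k] (h2 : (2 : k) ≠ 0)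
    {m : ℕ} (hm : 1 ≤ m) (c : k) (hc : c ≠ 0) (q : QuadraticForm k (Fin (2 * m + 1) → k))
    (hq : ∀ x : Fin (2 * m + 1) → k,
      q x = (∑ i : Fin m, x ⟨i.1, by have := i.2; omega⟩ * x ⟨m + i.1, by have := i.2; omega⟩)
        + c * x ⟨2 * m, by omega⟩ ^ 2) :
    (∃ W : Submodule k (Fin (2 * m + 1) → k),
        Module.finrank k W = m ∧ ∀ w ∈ W, q w = 0) ∧
    (∀ W : Submodule k (Fin (2 * m + 1) → k),
        (∀ w ∈ W, q w = 0) → Module.finrank k W ≤ m) := by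
  constructor
  · let s : Fin m → Fin (2 * m + 1) := Fin.castLE (by omega)
    have hs : Function.Injective s := Fin.castLE_injective _
    refine ⟨LinearMap.range (Function.ExtendByZero.linearMap k s), ?_, ?_⟩
    · rw [LinearMap.finrank_range_of_inj (Function.extend_injective hs _),
        Module.finrank_fin_fun]
    · rintro _ ⟨f, rfl⟩
      have hzero (j : ℕ) (hj : j < 2 * m + 1) (hmj : m ≤ j) :
          Function.ExtendByZero.linearMap k s f ⟨j, hj⟩ = 0 := by
        refine Function.extend_apply' f (0 : Fin (2 * m + 1) → k) _ ?_
        rintro ⟨i, hi⟩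
        have : i.1 = j := congrArg Fin.val hi
        omega
      rw [hq, hzero (2 * m) _ (by omega), Finset.sum_eq_zero]
      · simp
      · intro i _
        rw [hzero (m + i.1) _ (by omega), mul_zero]
  · intro W hW
    have hsep : LinearMap.SeparatingLeft q.polarBilin := by
      refine QuadraticForm.separatingLeft_polarBilin_of_hyperbolic_add_sq h2
        ?_ ?_ ?_ ?_ ?_ ?_ hc q hq
      · intro i j h
        simpa [Fin.ext_iff] using h
      · intro i j h
        simpa [Fin.ext_iff] using h
      · intro i j h
        simp only [Fin.mk.injEq] at h
        omega
      · intro i h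
        simp only [Fin.mk.injEq] at h
        omega
      · intro i h
        simp only [Fin.mk.injEq] at h
        omega
      · rintro ⟨j, hj⟩
        simp only [Fin.mk.injEq]
        rcases lt_or_ge j m with h | h
        · exact .inl ⟨⟨j, h⟩, rfl⟩
        · rcases eq_or_ne (2 * m) j with h' | h'
          · exact .inr (.inr h')
          · exact .inr (.inl ⟨⟨j - m, by omega⟩, Nat.add_sub_of_le h⟩)
    have h := q.two_mul_finrank_le_of_isotropic hsep W hW
    rw [Module.finrank_fin_fun] at h
    omega
end

section
/- Let k be a field of characteristic different from 2 and let f and g be quadratic forms on k^{n+1}. Let L/k be a finite field extension whose degree [L:k] is odd. If the base changes f_L and g_L have a common nontrivial zero over L (i.e., there exists a nonzero w in L^{n+1} with f_L(w) = 0 and g_L(w) = 0), then f and g have a common nontrivial zero over k (i.e., there exists a nonzero v in k^{n+1} with f(v) = 0 and g(v) = 0). -/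
open Polynomial Matrix

section QuadraticEval

variable {ι : Type*} [Fintype ι]

theorem RingHom.map_dotProduct_mulVec {R S : Type*} [CommRing R] [CommRing S] (φ : R →+* S)
    (A : Matrix ι ι R) (u v : ι → R) :
    φ (u ⬝ᵥ A *ᵥ v) = (φ ∘ u) ⬝ᵥ A.map φ *ᵥ (φ ∘ v) := by
  rw [RingHom.map_dotProduct]
  congr 1
  ext i
  exact RingHom.map_mulVec φ A v i

theorem smul_dotProduct_mulVec_smul {R : Type*} [CommRing R] (A : Matrix ι ι R) (c : R)
    (v : ι → R) : (c • v) ⬝ᵥ A *ᵥ (c • v) = c ^ 2 * (v ⬝ᵥ A *ᵥ v) := by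
  simp only [mulVec_smul, smul_dotProduct, dotProduct_smul, smul_eq_mul]
  ring

/-- An anisotropic quadratic form over a field takes polynomial vectors of maximal degree `m` to
polynomials of degree exactly `2 * m`. -/
theorem exists_natDegree_dotProduct_mulVec {K : Type*} [Field K] (A : Matrix ι ι K)
    (hA : ∀ u : ι → K, u ⬝ᵥ A *ᵥ u = 0 → u = 0) (v : ι → K[X]) (hv : v ≠ 0) :
    ∃ m, (∃ i, v i ≠ 0 ∧ (v i).natDegree = m) ∧ v ⬝ᵥ A.map C *ᵥ v ≠ 0 ∧
      (v ⬝ᵥ A.map C *ᵥ v).natDegree = 2 * m := by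
  classical
  obtain ⟨i₁, hi₁⟩ := Function.ne_iff.1 hv
  obtain ⟨i, hi, hmax⟩ := Finset.exists_max_image (Finset.univ.filter fun i => v i ≠ 0)
    (fun i => (v i).natDegree) ⟨i₁, by simpa using hi₁⟩
  simp only [Finset.mem_filter, Finset.mem_univ, true_and] at hi hmax
  have hle : ∀ j, (v j).natDegree ≤ (v i).natDegree := fun j => by
    by_cases hj : v j = 0
    · simp [hj]
    · exact hmax j hj
  set m := (v i).natDegree with hm
  have hle' : ∀ j, ((A.map C *ᵥ v) j).natDegree ≤ m := fun j => by
    refine natDegree_sum_le_of_forall_le _ _ fun l _ => ?_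
    exact (natDegree_C_mul_le _ _).trans (hle l)
  have hco : (v ⬝ᵥ A.map C *ᵥ v).coeff (m + m) =
      (fun j => (v j).coeff m) ⬝ᵥ A *ᵥ (fun j => (v j).coeff m) := by
    rw [dotProduct, finsetSum_coeff]
    refine Finset.sum_congr rfl fun j _ => ?_
    rw [coeff_mul_add_eq_of_natDegree_le (hle j) (hle' j)]
    congr 1
    simp [mulVec, dotProduct]
  have hne : (v ⬝ᵥ A.map C *ᵥ v).coeff (m + m) ≠ 0 := fun h0 => by
    rw [hco] at h0
    exact hi (leadingCoeff_eq_zero.1 (congrFun (hA _ h0) i))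
  refine ⟨m, ⟨i, hi, rfl⟩, fun h => hne (by simp [h]), ?_⟩
  refine le_antisymm ?_ (two_mul m ▸ le_natDegree_of_ne_zero hne)
  refine natDegree_sum_le_of_forall_le _ _ fun j _ => ?_
  exact natDegree_mul_le.trans (by have := hle j; have := hle' j; omega)

/-- Springer's theorem in polynomial form: if an anisotropic quadratic form takes a value divisible
by a polynomial `p` of odd degree at a vector of polynomials, then `p` and the entries of that
vector are not jointly coprime. -/
theorem not_exists_add_dotProduct_eq_one_of_odd_natDegree {K : Type*} [Field K] (A : Matrix ι ι K)
    (hA : ∀ u : ι → K, u ⬝ᵥ A *ᵥ u = 0 → u = 0) (d : ℕ) :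
    ∀ (p : K[X]) (v : ι → K[X]), p.natDegree = d → Odd d → p ∣ v ⬝ᵥ A.map C *ᵥ v →
      ¬ ∃ (a : K[X]) (b : ι → K[X]), a * p + b ⬝ᵥ v = 1 := by
  induction d using Nat.strong_induction_on with
  | _ d ih =>
  rintro p v₀ hp hd hdvd₀ ⟨a₀, b₀, hab₀⟩
  have hp0 : p ≠ 0 := by rintro rfl; simp at hp; simp [← hp] at hd
  obtain ⟨v, hvdeg, a, b, hab, hdvd⟩ : ∃ v : ι → K[X], (∀ i, (v i).degree < p.degree) ∧
      ∃ (a : K[X]) (b : ι → K[X]), a * p + b ⬝ᵥ v = 1 ∧ p ∣ v ⬝ᵥ A.map C *ᵥ v := by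
    have hdec : v₀ = (fun i => v₀ i % p) + p • (fun i => v₀ i / p) := by
      ext1 i
      simp [EuclideanDomain.mod_add_div]
    refine ⟨fun i => v₀ i % p, fun i => EuclideanDomain.mod_lt _ hp0,
      a₀ + b₀ ⬝ᵥ (fun i => v₀ i / p), b₀, ?_, ?_⟩
    · rw [hdec] at hab₀
      simp only [dotProduct_add, dotProduct_smul, smul_eq_mul] at hab₀
      linear_combination hab₀
    · rw [hdec] at hdvd₀
      simp only [dotProduct_add, add_dotProduct, mulVec_add, mulVec_smul, dotProduct_smul,
        smul_dotProduct, smul_eq_mul, add_assoc] at hdvd₀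
      refine (dvd_add_left ?_).1 hdvd₀
      exact dvd_add (dvd_mul_right _ _) (dvd_mul_right _ _)
  have hv : v ≠ 0 := by
    rintro rfl
    have : IsUnit p := IsUnit.of_mul_eq_one a (by simpa [mul_comm] using hab)
    simp [natDegree_eq_zero_of_isUnit this ▸ hp.symm] at hd
  obtain ⟨c, hc⟩ := (IsPrincipalIdealRing.principal (Ideal.span (Set.range v))).principal
  have hcv : ∀ i, ∃ w, v i = c * w := fun i => by
    have : v i ∈ Ideal.span (Set.range v) := Ideal.subset_span ⟨i, rfl⟩
    rw [hc] at this
    exact Ideal.mem_span_singleton.1 this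
  choose w hw using hcv
  have hvw : v = c • w := funext hw
  have hc0 : c ≠ 0 := by rintro rfl; simp [hvw] at hv
  obtain ⟨e, he⟩ : ∃ e : ι → K[X], e ⬝ᵥ w = 1 := by
    have : c ∈ Ideal.span (Set.range v) := by
      rw [hc]; exact Ideal.mem_span_singleton_self c
    obtain ⟨e, he⟩ := (Submodule.mem_span_range_iff_exists_fun _).1 this
    refine ⟨e, mul_left_cancel₀ hc0 ?_⟩
    rw [mul_one, ← smul_eq_mul, ← dotProduct_smul, ← hvw, ← he]
    rfl
  have hw0 : w ≠ 0 := by rintro rfl; simp at he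
  have hcop : IsCoprime p c := by
    refine ⟨a, b ⬝ᵥ w, ?_⟩
    rw [hvw, dotProduct_smul, smul_eq_mul] at hab
    linear_combination hab
  rw [hvw, smul_dotProduct_mulVec_smul] at hdvd
  obtain ⟨h, hh⟩ := (hcop.pow_right).dvd_of_dvd_mul_left hdvd
  obtain ⟨m, ⟨i, hi0, hi⟩, hne, hdeg⟩ := exists_natDegree_dotProduct_mulVec A hA w hw0
  have hh0 : h ≠ 0 := by rintro rfl; simp [hh] at hne
  have hm : m < d := by
    have h1 := natDegree_lt_natDegree (by simp [hw i, hc0, hi0]) (hvdeg i)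
    rw [hw i, natDegree_mul hc0 hi0] at h1
    omega
  rw [hh, natDegree_mul hp0 hh0, hp] at hdeg
  refine ih h.natDegree (by omega) h w rfl ?_ ⟨p, by rw [hh, mul_comm]⟩ ⟨0, e, by simpa using he⟩
  obtain ⟨r, hr⟩ := hd
  exact ⟨m - r - 1, by omega⟩

/-- If the pencil `A + X B` has a nontrivial zero with polynomial entries, then `A` and `B` have a
common nontrivial zero: the degree of the polynomial vector is lowered by reflecting it in its
constant term. -/
theorem exists_common_zero_of_degree_lt {K : Type*} [Field K] (A B : Matrix ι ι K) (d : ℕ) :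
    ∀ v : ι → K[X], v ≠ 0 → (∀ i, (v i).degree < d) →
      v ⬝ᵥ (A.map C + (X : K[X]) • B.map C) *ᵥ v = 0 →
      ∃ u : ι → K, u ≠ 0 ∧ u ⬝ᵥ A *ᵥ u = 0 ∧ u ⬝ᵥ B *ᵥ u = 0 := by
  induction d with
  | zero =>
    intro v hv hd
    refine (hv (funext fun i => ?_)).elim
    simpa using hd i
  | succ d ih =>
    intro v hv hd hz
    set Φ := A.map C + (X : K[X]) • B.map C with hΦ
    set u : ι → K := fun i => (v i).coeff 0 with hu
    set U : ι → K[X] := C ∘ u with hU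
    set w : ι → K[X] := fun i => (v i).divX with hw
    have hvw : v = U + (X : K[X]) • w := by
      ext1 i
      simp [hU, hu, hw, add_comm, X_mul_divX_add]
    have hwdeg : ∀ i m, d ≤ m → (w i).coeff m = 0 := fun i m hm => by
      rw [hw, coeff_divX]
      exact (degree_lt_iff_coeff_zero _ _).1 (hd i) _ (by omega)
    have hΦU : U ⬝ᵥ Φ *ᵥ U = C (u ⬝ᵥ A *ᵥ u) + X * C (u ⬝ᵥ B *ᵥ u) := by
      rw [RingHom.map_dotProduct_mulVec, RingHom.map_dotProduct_mulVec, hΦ, add_mulVec,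
        dotProduct_add, smul_mulVec, dotProduct_smul, smul_eq_mul]
    have hexp : U ⬝ᵥ Φ *ᵥ U + X * (U ⬝ᵥ Φ *ᵥ w + w ⬝ᵥ Φ *ᵥ U + X * (w ⬝ᵥ Φ *ᵥ w)) = 0 := by
      rw [← hz, hvw]
      simp only [dotProduct_add, add_dotProduct, mulVec_add, mulVec_smul, dotProduct_smul,
        smul_dotProduct, smul_eq_mul]
      ring
    have hAu : u ⬝ᵥ A *ᵥ u = 0 := by
      have := congrArg (eval 0) hexp
      simpa [hΦU] using this
    rw [hΦU, hAu, C_0, zero_add, ← mul_add] at hexp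
    rw [hAu, C_0, zero_add] at hΦU
    have hrel := (mul_eq_zero.1 hexp).resolve_left X_ne_zero
    by_cases hu0 : u = 0
    · have hU0 : U = 0 := by ext1 i; simp [hU, hu0]
      rw [hU0, zero_add] at hvw
      refine ih w (by rintro h; simp [hvw, h] at hv)
        (fun i => (degree_lt_iff_coeff_zero _ _).2 (hwdeg i)) ?_
      rw [hvw, smul_dotProduct_mulVec_smul] at hz
      exact (mul_eq_zero.1 hz).resolve_left (pow_ne_zero _ X_ne_zero)
    by_cases hβ : u ⬝ᵥ B *ᵥ u = 0
    · exact ⟨u, hu0, hAu, hβ⟩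
    set β := u ⬝ᵥ B *ᵥ u with hβ'
    have hβC : C β * C β⁻¹ = 1 := by rw [← C_mul, mul_inv_cancel₀ hβ, C_1]
    set s := C β⁻¹ * (w ⬝ᵥ Φ *ᵥ w) with hs
    refine ih (w + s • U) ?_ ?_ ?_
    · intro h0
      have hws : w = (-s) • U := by
        rw [neg_smul]; exact eq_neg_of_add_eq_zero_left h0
      have hs2 : w ⬝ᵥ Φ *ᵥ w = s ^ 2 * (X * C β) := by
        conv_lhs => rw [hws, smul_dotProduct_mulVec_smul, hΦU]
        ring
      have hs3 : s * (1 - s * X) = 0 := by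
        have : s = s ^ 2 * X * (C β * C β⁻¹) := by
          conv_lhs => rw [hs, hs2]
          ring
        rw [hβC] at this
        linear_combination this
      rcases mul_eq_zero.1 hs3 with h | h
      · have hw0 : w = 0 := by rw [hws, h]; simp
        rw [hw0] at hrel
        simp [hβ] at hrel
      · simpa using congrArg (eval 0) h
    · have hlin : ∀ (M : Matrix ι ι K) (m : ℕ), d ≤ m →
          (U ⬝ᵥ M.map C *ᵥ w).coeff m = 0 ∧ (w ⬝ᵥ M.map C *ᵥ U).coeff m = 0 := by
        intro M m hm
        constructor
        · rw [dotProduct, finsetSum_coeff]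
          refine Finset.sum_eq_zero fun i _ => ?_
          simp [hU, mulVec, dotProduct, hwdeg _ m hm]
        · rw [dotProduct, finsetSum_coeff]
          refine Finset.sum_eq_zero fun i _ => ?_
          have : (M.map C *ᵥ U) i = C ((M *ᵥ u) i) := (RingHom.map_mulVec C M u i).symm
          rw [this, coeff_mul_C, hwdeg _ m hm, zero_mul]
      have hcoeff : ∀ m, d ≤ m → (w ⬝ᵥ Φ *ᵥ w).coeff m = 0 := by
        intro m hm
        have := congrArg (fun q => coeff q (m + 1)) hrel
        simpa [hΦ, add_mulVec, smul_mulVec, coeff_C, coeff_X_mul, hlin A (m + 1) (by omega),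
          hlin B m hm, -coeff_map] using this
      intro i
      refine (degree_lt_iff_coeff_zero _ _).2 fun m hm => ?_
      simp [hU, hs, hwdeg i m hm, hcoeff m hm]
    · have : (w + s • U) ⬝ᵥ Φ *ᵥ (w + s • U) = w ⬝ᵥ Φ *ᵥ w + s * (U ⬝ᵥ Φ *ᵥ w + w ⬝ᵥ Φ *ᵥ U) +
          s ^ 2 * (U ⬝ᵥ Φ *ᵥ U) := by
        simp only [dotProduct_add, add_dotProduct, mulVec_add, mulVec_smul, dotProduct_smul,
          smul_dotProduct, smul_eq_mul]
        ring
      rw [this, hΦU]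
      linear_combination s * hrel + (X * s * (w ⬝ᵥ Φ *ᵥ w) - w ⬝ᵥ Φ *ᵥ w) * hβC


/-- Amer's theorem for a pair of quadratic forms: if the pencil `A + X B` is isotropic over `K(X)`,
then `A` and `B` have a common nontrivial zero over `K`. -/
theorem exists_common_zero_of_ratFunc {K : Type*} [Field K] (A B : Matrix ι ι K)
    (y : ι → RatFunc K) (hy : y ≠ 0)
    (h : y ⬝ᵥ (A.map C + (X : K[X]) • B.map C).map (algebraMap K[X] (RatFunc K)) *ᵥ y = 0) :
    ∃ u : ι → K, u ≠ 0 ∧ u ⬝ᵥ A *ᵥ u = 0 ∧ u ⬝ᵥ B *ᵥ u = 0 := by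
  obtain ⟨b, hb⟩ := IsLocalization.exist_integer_multiples (nonZeroDivisors K[X]) Finset.univ y
  choose v hv using fun i => hb i (Finset.mem_univ i)
  have hb0 : algebraMap K[X] (RatFunc K) b ≠ 0 := by
    simp
  have hvy : (algebraMap K[X] (RatFunc K)) ∘ v = algebraMap K[X] (RatFunc K) b • y := by
    ext1 i
    simp [hv i, Algebra.smul_def]
  refine exists_common_zero_of_degree_lt A B (Finset.univ.sup (fun i => (v i).natDegree) + 1) v ?_
    (fun i => ?_) ?_
  · rintro rfl
    refine hy ((smul_eq_zero.1 (hvy.symm.trans ?_)).resolve_left hb0)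
    ext1 i
    simp
  · refine degree_le_natDegree.trans_lt (Nat.cast_lt.2 (Nat.lt_succ_of_le ?_))
    exact Finset.le_sup (f := fun i => (v i).natDegree) (Finset.mem_univ i)
  · apply IsFractionRing.injective K[X] (RatFunc K)
    rw [RingHom.map_dotProduct_mulVec, hvy, smul_dotProduct_mulVec_smul, h, mul_zero, map_zero]

/-- If two quadratic forms take values divisible by an irreducible polynomial `p` of odd degree at a
vector of polynomials that is nonzero modulo `p`, then they have a common nontrivial zero. -/
theorem exists_common_zero_of_dvd {K : Type*} [Field K] (A B : Matrix ι ι K) (p : K[X])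
    (hp : Irreducible p) (hodd : Odd p.natDegree) (v : ι → K[X]) (hv : ∃ i, ¬ p ∣ v i)
    (hA : p ∣ v ⬝ᵥ A.map C *ᵥ v) (hB : p ∣ v ⬝ᵥ B.map C *ᵥ v) :
    ∃ u : ι → K, u ≠ 0 ∧ u ⬝ᵥ A *ᵥ u = 0 ∧ u ⬝ᵥ B *ᵥ u = 0 := by
  classical
  by_contra hno
  let μ : K[X] →+* (RatFunc K)[X] := mapRingHom (algebraMap K (RatFunc K))
  obtain ⟨i, hi⟩ := hv
  obtain ⟨a, b, hab⟩ := (hp.coprime_iff_not_dvd).2 hi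
  refine not_exists_add_dotProduct_eq_one_of_odd_natDegree
    ((A.map C + (X : K[X]) • B.map C).map (algebraMap K[X] (RatFunc K)))
    (fun y hy => by_contra fun hy0 => hno (exists_common_zero_of_ratFunc A B y hy0 hy))
    p.natDegree (μ p) (μ ∘ v) (natDegree_map _) hodd ?_ ⟨μ a, Pi.single i (μ b), ?_⟩
  · have hΦ : ((A.map C + (X : K[X]) • B.map C).map (algebraMap K[X] (RatFunc K))).map C =
        (A.map C).map μ + C (algebraMap K[X] (RatFunc K) X) • (B.map C).map μ := by
      ext1 i j
      simp only [μ, RatFunc.algebraMap_eq_C, map_apply, Matrix.add_apply, Matrix.smul_apply,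
        smul_eq_mul, map_add, map_mul, RatFunc.algebraMap_C, coe_mapRingHom, Polynomial.map_C]
    rw [hΦ, add_mulVec, dotProduct_add, smul_mulVec, dotProduct_smul,
      ← RingHom.map_dotProduct_mulVec, ← RingHom.map_dotProduct_mulVec]
    exact dvd_add (map_dvd μ hA) ((map_dvd μ hB).mul_left _)
  · rw [single_dotProduct, Function.comp_apply, ← map_mul, ← map_mul, ← map_add, hab, map_one]

/-- Descent of common zeros of two quadratic forms along a simple extension of odd degree. -/
theorem exists_common_zero_of_mem_adjoin {K L : Type*} [Field K] [Field L] [Algebra K L]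
    (A B : Matrix ι ι K) (x : L) (hx : IsIntegral K x) (hodd : Odd (minpoly K x).natDegree)
    (w : ι → L) (hw : w ≠ 0) (hmem : ∀ i, w i ∈ IntermediateField.adjoin K {x})
    (hA : w ⬝ᵥ A.map (algebraMap K L) *ᵥ w = 0) (hB : w ⬝ᵥ B.map (algebraMap K L) *ᵥ w = 0) :
    ∃ u : ι → K, u ≠ 0 ∧ u ⬝ᵥ A *ᵥ u = 0 ∧ u ⬝ᵥ B *ᵥ u = 0 := by
  have hpoly : ∀ i, ∃ q : K[X], aeval x q = w i := fun i => by
    have := hmem i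
    rwa [← IntermediateField.mem_toSubalgebra,
      IntermediateField.adjoin_simple_toSubalgebra_of_isAlgebraic hx.isAlgebraic,
      Algebra.adjoin_singleton_eq_range_aeval] at this
  choose v hv using hpoly
  have hval : ∀ M : Matrix ι ι K,
      aeval x (v ⬝ᵥ M.map C *ᵥ v) = w ⬝ᵥ M.map (algebraMap K L) *ᵥ w := fun M => by
    have hvw : (aeval x : K[X] →ₐ[K] L).toRingHom ∘ v = w := funext hv
    have hM : (M.map C).map (aeval x : K[X] →ₐ[K] L).toRingHom = M.map (algebraMap K L) := by
      ext1 i j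
      simp
    rw [← hM, ← hvw]
    exact RingHom.map_dotProduct_mulVec (aeval x : K[X] →ₐ[K] L).toRingHom _ _ _
  obtain ⟨i, hi⟩ := Function.ne_iff.1 hw
  refine exists_common_zero_of_dvd A B (minpoly K x) (minpoly.irreducible hx) hodd v
    ⟨i, fun h => hi ?_⟩ (minpoly.dvd K x (by rw [hval, hA])) (minpoly.dvd K x (by rw [hval, hB]))
  rw [← hv i, Pi.zero_apply]
  exact (minpoly.dvd_iff).1 h

/-- Descent of common zeros of two quadratic forms, given by matrices, along a finite extension of
odd degree. -/
theorem exists_common_zero_of_odd_finrank {k L : Type*} [Field k] [Field L] [Algebra k L]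
    [FiniteDimensional k L] (hodd : Odd (Module.finrank k L)) (A B : Matrix ι ι k)
    (w : ι → L) (hw : w ≠ 0)
    (hA : w ⬝ᵥ A.map (algebraMap k L) *ᵥ w = 0) (hB : w ⬝ᵥ B.map (algebraMap k L) *ᵥ w = 0) :
    ∃ u : ι → k, u ≠ 0 ∧ u ⬝ᵥ A *ᵥ u = 0 ∧ u ⬝ᵥ B *ᵥ u = 0 := by
  have hcomp : ∀ (M : IntermediateField k L) (D : Matrix ι ι k),
      (D.map (algebraMap k M)).map (algebraMap M L) = D.map (algebraMap k L) := fun M D => by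
    ext1 i j
    rfl
  refine IntermediateField.induction_on_adjoin
    (fun M : IntermediateField k L => ∀ w : ι → L, w ≠ 0 → (∀ i, w i ∈ M) →
      w ⬝ᵥ A.map (algebraMap k L) *ᵥ w = 0 → w ⬝ᵥ B.map (algebraMap k L) *ᵥ w = 0 →
      ∃ u : ι → k, u ≠ 0 ∧ u ⬝ᵥ A *ᵥ u = 0 ∧ u ⬝ᵥ B *ᵥ u = 0)
    ?_ ?_ ⊤ w hw (fun _ => IntermediateField.mem_top) hA hB
  · intro w hw hmem hA hB
    choose u hu using fun i => IntermediateField.mem_bot.1 (hmem i)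
    obtain rfl : algebraMap k L ∘ u = w := funext hu
    rw [← RingHom.map_dotProduct_mulVec, map_eq_zero] at hA hB
    refine ⟨u, ?_, hA, hB⟩
    rintro rfl
    exact hw (funext fun i => by simp)
  · intro M x ih w hw hmem hA hB
    have hx : IsIntegral M x := Algebra.IsIntegral.isIntegral x
    have hdeg : Odd (minpoly M x).natDegree := by
      rw [← IntermediateField.adjoin.finrank hx]
      refine hodd.of_dvd_nat ((Dvd.intro _
        (Module.finrank_mul_finrank M (IntermediateField.adjoin M {x}) L)).trans
        (Dvd.intro_left _ (Module.finrank_mul_finrank k M L)))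
    obtain ⟨u, hu, huA, huB⟩ := exists_common_zero_of_mem_adjoin (A.map (algebraMap k M))
      (B.map (algebraMap k M)) x hx hdeg w hw hmem (by rwa [hcomp]) (by rwa [hcomp])
    refine ih (algebraMap M L ∘ u) ?_ (fun i => (u i).2) ?_ ?_
    · obtain ⟨i, hi⟩ := Function.ne_iff.1 hu
      exact Function.ne_iff.2 ⟨i, by simpa using hi⟩
    · rw [← hcomp M, ← RingHom.map_dotProduct_mulVec, huA, map_zero]
    · rw [← hcomp M, ← RingHom.map_dotProduct_mulVec, huB, map_zero]

end QuadraticEval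

/-- A quadratic form on `k^n` is given by a matrix over `k`, which also gives all its base changes. -/
theorem QuadraticForm.exists_matrix_baseChangePi {k : Type*} [Field k] (h2 : (2 : k) ≠ 0) {n : ℕ}
    (Q : QuadraticForm k (Fin n → k)) :
    ∃ A : Matrix (Fin n) (Fin n) k, (∀ v, Q v = v ⬝ᵥ A *ᵥ v) ∧
      ∀ (L : Type*) [Field L] [Algebra k L] (w : Fin n → L),
        Q.baseChangePi L h2 w = w ⬝ᵥ A.map (algebraMap k L) *ᵥ w := by
  let : Invertible (2 : k) := invertibleOfNonzero h2
  let b := QuadraticMap.associated (R := k) Q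
  refine ⟨LinearMap.toMatrix₂' k b, fun v => ?_, fun L _ _ w => ?_⟩
  · rw [← QuadraticMap.associated_eq_self_apply k Q v]
    change b v v = _
    rw [← Matrix.toLinearMap₂'_apply', Matrix.toLinearMap₂'_toMatrix']
  · let : Invertible (2 : L) := (Invertible.map (algebraMap k L) 2).copy 2 (map_ofNat _ 2).symm
    change Q.baseChange L ((TensorProduct.piScalarRight k L L (Fin n)).symm w) = _
    rw [← QuadraticMap.associated_eq_self_apply L (Q.baseChange L),
      QuadraticForm.associated_baseChange]
    conv_lhs => rw [← Finset.univ_sum_single w]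
    simp only [map_sum, TensorProduct.piScalarRight_symm_single, LinearMap.sum_apply,
      LinearMap.BilinForm.baseChange_tmul]
    simp only [dotProduct, mulVec, Finset.mul_sum, Algebra.smul_def, Matrix.map_apply,
      LinearMap.toMatrix₂'_apply]
    rw [Finset.sum_comm]
    refine Finset.sum_congr rfl fun i _ => Finset.sum_congr rfl fun j _ => ?_
    ring

/-- If two quadratic forms over a field `k` of characteristic `≠ 2` acquire a common
nontrivial zero over a finite field extension `L/k` of odd degree, then they already
have a common nontrivial zero over `k`. -/
theorem common_zero_odd_degree_descent {n : ℕ} {k L : Type*} [Field k] [Field L] [Algebra k L]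
    (h2 : (2 : k) ≠ 0) [FiniteDimensional k L] (hodd : Odd (Module.finrank k L))
    (f g : QuadraticForm k (Fin (n + 1) → k))
    (hL : ∃ w : Fin (n + 1) → L, w ≠ 0 ∧
        f.baseChangePi L h2 w = 0 ∧ g.baseChangePi L h2 w = 0) :
    ∃ v : Fin (n + 1) → k, v ≠ 0 ∧ f v = 0 ∧ g v = 0 := by
  obtain ⟨A, hAk, hAL⟩ := f.exists_matrix_baseChangePi h2
  obtain ⟨B, hBk, hBL⟩ := g.exists_matrix_baseChangePi h2
  obtain ⟨w, hw, hf, hg⟩ := hL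
  obtain ⟨u, hu, huA, huB⟩ := exists_common_zero_of_odd_finrank hodd A B w hw
    (hAL L w ▸ hf) (hBL L w ▸ hg)
  exact ⟨u, hu, (hAk u).trans huA, (hBk u).trans huB⟩
end

section
/- Let k be an algebraically closed field of characteristic different from 2 and let f and g be quadratic forms on k^n with n ≥ 1. Then there exists a k-subspace of k^n of dimension ⌊(n−1)/2⌋ on which both f and g vanish identically. -/
open Polynomial in
/-- Lagrange interpolation: the divided difference of a polynomial of small degree vanishes. -/
theorem sum_eval_div_prod_sub_eq_zero {k : Type*} [Field k] {n : ℕ} {l : Fin n → k}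
    (hl : Function.Injective l) {P : k[X]} (hP : P.natDegree + 1 < n) :
    ∑ i, P.eval (l i) / ∏ j ∈ Finset.univ.erase i, (l i - l j) = 0 := by
  have hdeg : P.degree < (Finset.univ : Finset (Fin n)).card := by
    refine lt_of_le_of_lt P.degree_le_natDegree ?_
    simp only [Finset.card_univ, Fintype.card_fin, Nat.cast_lt]
    omega
  rw [← Lagrange.coeff_eq_sum hl.injOn hdeg]
  apply coeff_eq_zero_of_natDegree_lt
  simp only [Finset.card_univ, Fintype.card_fin]
  omega

namespace LinearMap

universe u v

variable {k : Type v} [Field k] {V : Type u} [AddCommGroup V] [Module k V]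

/-- The pencil spanned by `B` and `C` has a common nonzero isotropic vector `v` at which the
functionals `B v` and `C v` are proportional. -/
def HasSingularZero (B C : V →ₗ[k] V →ₗ[k] k) : Prop :=
  ∃ v ≠ 0, B v v = 0 ∧ C v v = 0 ∧
    ∃ (ψ : V →ₗ[k] k) (s t : k), B v = s • ψ ∧ C v = t • ψ

theorem finrank_le_finrank_ker_inf_ker_add_two [FiniteDimensional k V] (φ ψ : V →ₗ[k] k) :
    Module.finrank k V ≤ Module.finrank k (ker φ ⊓ ker ψ : Submodule k V) + 2 := by
  have h := (φ.prod ψ).finrank_range_add_finrank_ker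
  have h' := Submodule.finrank_le (range (φ.prod ψ))
  rw [ker_prod] at h
  rw [Module.finrank_prod, Module.finrank_self] at h'
  omega

/-- Some nonzero vector has proportional associated functionals. -/
theorem exists_proportional_apply [IsAlgClosed k] [FiniteDimensional k V] [Nontrivial V]
    (B C : V →ₗ[k] V →ₗ[k] k) :
    ∃ v ≠ 0, ∃ (ψ : V →ₗ[k] k) (s t : k), B v = s • ψ ∧ C v = t • ψ := by
  by_cases hB : Function.Injective B
  · let E : V ≃ₗ[k] (V →ₗ[k] k) :=
      LinearEquiv.ofInjectiveOfFinrankEq B hB (Subspace.dual_finrank_eq (K := k) (V := V)).symm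
    obtain ⟨a, ha⟩ := Module.End.exists_eigenvalue (E.symm.toLinearMap ∘ₗ C)
    obtain ⟨v, hv⟩ := ha.exists_hasEigenvector
    refine ⟨v, hv.2, B v, 1, a, (one_smul _ _).symm, ?_⟩
    have h : E.symm (C v) = a • v := hv.apply_eq_smul
    rw [LinearEquiv.symm_apply_eq, map_smul] at h
    exact h
  · rw [← ker_eq_bot, Submodule.eq_bot_iff] at hB
    push Not at hB
    obtain ⟨v, hv, hv0⟩ := hB
    exact ⟨v, hv0, C v, 0, 1, by simpa using hv, (one_smul _ _).symm⟩

/-- A pencil without singular zeros is diagonal in a suitable basis `e` with dual basis `ψ`. -/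
theorem exists_diagonalization [IsAlgClosed k] (n : ℕ) :
    ∀ {V : Type u} [AddCommGroup V] [Module k V] [FiniteDimensional k V]
      (B C : V →ₗ[k] V →ₗ[k] k), (∀ v w, B v w = B w v) → (∀ v w, C v w = C w v) →
      Module.finrank k V = n → ¬ HasSingularZero B C →
      ∃ (e : Fin n → V) (ψ : Fin n → (V →ₗ[k] k)) (b c : Fin n → k),
        (∀ i, B (e i) = b i • ψ i) ∧ (∀ i, C (e i) = c i • ψ i) ∧
        ∀ i j, ψ i (e j) = if i = j then 1 else 0 := by
  induction n with
  | zero =>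
    intro V _ _ _ B C _ _ _ _
    exact ⟨Fin.elim0, Fin.elim0, Fin.elim0, Fin.elim0, fun i => i.elim0, fun i => i.elim0,
      fun i => i.elim0⟩
  | succ n ih =>
    intro V _ _ _ B C hB hC hV hS
    have : Nontrivial V := Module.nontrivial_of_finrank_pos (R := k) (by omega)
    obtain ⟨v, hv, χ, s, t, hs, ht⟩ := exists_proportional_apply B C
    have hχ : χ v ≠ 0 := by
      intro h
      exact hS ⟨v, hv, by simp [hs, h], by simp [ht, h], χ, s, t, hs, ht⟩
    obtain ⟨φ, b₀, c₀, hb₀, hc₀, hφ⟩ : ∃ (φ : V →ₗ[k] k) (b₀ c₀ : k),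
        B v = b₀ • φ ∧ C v = c₀ • φ ∧ φ v = 1 := by
      refine ⟨(χ v)⁻¹ • χ, s * χ v, t * χ v, ?_, ?_, by simp [hχ]⟩
      · rw [hs, smul_smul, mul_assoc, mul_inv_cancel₀ hχ, mul_one]
      · rw [ht, smul_smul, mul_assoc, mul_inv_cancel₀ hχ, mul_one]
    have hφ0 : φ ≠ 0 := by rintro rfl; simp at hφ
    let U := ker φ
    have hU : Module.finrank k U = n := by
      have := Module.Dual.finrank_ker_add_one_of_ne_zero (f := φ) hφ0
      have h2 : Module.finrank k U + 1 = Module.finrank k V := this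
      omega
    let π : V →ₗ[k] U := (LinearMap.id - φ.smulRight v).codRestrict U (by
      intro w
      simp [U, hφ])
    have hπ : ∀ w, ((π w : U) : V) = w - φ w • v := fun w => rfl
    have hπU : ∀ u : U, π u = u := by
      intro u
      have hu : φ u = 0 := u.2
      ext
      simp [hπ, hu]
    have hπv : π v = 0 := by
      ext
      simp [hπ, hφ]
    have key : ∀ (D : V →ₗ[k] V →ₗ[k] k) (d : k), (∀ x y, D x y = D y x) → D v = d • φ →
        ∀ (u : U) (w : V), D u w = D.domRestrict₁₂ U U u (π w) := by
      intro D d hD hd u w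
      have hu : φ u = 0 := u.2
      rw [domRestrict₁₂_apply, hπ, map_sub, map_smul, hD u v, hd]
      simp [hu]
    have lift : ∀ (D : V →ₗ[k] V →ₗ[k] k) (d : k), (∀ x y, D x y = D y x) → D v = d • φ →
        ∀ (u : U) (r : k) (χ : U →ₗ[k] k), D.domRestrict₁₂ U U u = r • χ →
        D u = r • (χ ∘ₗ π) := by
      intro D d hD hd u r χ h
      ext w
      rw [key D d hD hd, h]
      simp
    obtain ⟨e, ψ, b, c, he, hc, hψ⟩ := ih (B.domRestrict₁₂ U U) (C.domRestrict₁₂ U U)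
      (fun x y => hB x y) (fun x y => hC x y) hU (by
        rintro ⟨u, hu, hBu, hCu, χ, s, t, hs, ht⟩
        exact hS ⟨u, by simpa using hu, hBu, hCu, χ ∘ₗ π, s, t,
          lift B b₀ hB hb₀ u s χ hs, lift C c₀ hC hc₀ u t χ ht⟩)
    refine ⟨Fin.cons v fun i => (e i : V), Fin.cons φ fun i => ψ i ∘ₗ π, Fin.cons b₀ b,
      Fin.cons c₀ c, ?_, ?_, ?_⟩
    · intro i
      refine Fin.cases ?_ (fun i => ?_) i
      · simpa using hb₀
      · simpa using lift B b₀ hB hb₀ _ _ _ (he i)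
    · intro i
      refine Fin.cases ?_ (fun i => ?_) i
      · simpa using hc₀
      · simpa using lift C c₀ hC hc₀ _ _ _ (hc i)
    · intro i j
      refine Fin.cases ?_ (fun i => ?_) i <;> refine Fin.cases ?_ (fun j => ?_) j
      · simp [hφ]
      · simp [(Fin.succ_ne_zero j).symm]
      · simp [hπv]
      · simp [hπU, hψ]

/-- In a diagonalization of a pencil without singular zeros the eigenvalues are distinct. -/
theorem mul_ne_mul_of_diagonalization [IsAlgClosed k] {n : ℕ} {B C : V →ₗ[k] V →ₗ[k] k}
    (hS : ¬ HasSingularZero B C) {e : Fin n → V} {ψ : Fin n → (V →ₗ[k] k)} {b c : Fin n → k}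
    (hb : ∀ i, B (e i) = b i • ψ i) (hc : ∀ i, C (e i) = c i • ψ i)
    (hψ : ∀ i j, ψ i (e j) = if i = j then 1 else 0) (h0 : ∀ i, b i ≠ 0 ∨ c i ≠ 0)
    {i j : Fin n} (hij : i ≠ j) : b i * c j ≠ b j * c i := by
  intro h
  obtain ⟨r, hr, hr'⟩ : ∃ r, b j = r * b i ∧ c j = r * c i := by
    rcases h0 i with hi | hi
    · exact ⟨b j / b i, by field_simp, by field_simp; linear_combination h⟩
    · exact ⟨c j / c i, by field_simp; linear_combination -h, by field_simp⟩
  obtain ⟨x, hx⟩ := IsAlgClosed.exists_pow_nat_eq (-r) (n := 2) (by norm_num)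
  refine hS ⟨x • e i + e j, ?_, ?_, ?_, x • ψ i + r • ψ j, b i, c i, ?_, ?_⟩
  · intro h
    have := congrArg (ψ j) h
    simp [hψ, hij.symm] at this
  · simp only [map_add, map_smul, hb, add_apply, smul_apply, hψ, hij, hij.symm, smul_eq_mul,
      if_true, if_false]
    linear_combination b i * hx + hr
  · simp only [map_add, map_smul, hc, add_apply, smul_apply, hψ, hij, hij.symm, smul_eq_mul,
      if_true, if_false]
    linear_combination c i * hx + hr'
  · rw [map_add, map_smul, hb, hb, hr]
    module
  · rw [map_add, map_smul, hc, hc, hr']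
    module

open Polynomial in
/-- A pencil without singular zeros has a large common isotropic subspace, given by the
polynomials of small degree in the eigenvalues. -/
theorem exists_isotropic_of_not_hasSingularZero [IsAlgClosed k] [FiniteDimensional k V]
    (B C : V →ₗ[k] V →ₗ[k] k) (hB : ∀ v w, B v w = B w v) (hC : ∀ v w, C v w = C w v)
    (hS : ¬ HasSingularZero B C) (m : ℕ) (hm : 2 * m + 1 ≤ Module.finrank k V) :
    ∃ W : Submodule k V, Module.finrank k W = m ∧ ∀ w ∈ W, B w w = 0 ∧ C w w = 0 := by
  obtain ⟨e, ψ, b, c, hb, hc, hψ⟩ := exists_diagonalization _ B C hB hC rfl hS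
  generalize Module.finrank k V = n at *
  have h0 : ∀ i, b i ≠ 0 ∨ c i ≠ 0 := by
    intro i
    by_contra! h
    refine hS ⟨e i, ?_, by simp [hb, h.1], by simp [hc, h.2], ψ i, b i, c i, hb i, hc i⟩
    intro h
    simpa [h] using hψ i i
  have hne := fun i j (hij : i ≠ j) => mul_ne_mul_of_diagonalization hS hb hc hψ h0 hij
  obtain ⟨t, ht⟩ : ∃ t : k, ∀ i, b i + t * c i ≠ 0 := by
    classical
    obtain ⟨t, ht⟩ := Infinite.exists_notMem_finset (Finset.univ.image fun i => -b i / c i)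
    refine ⟨t, fun i hi => ?_⟩
    by_cases hci : c i = 0
    · rcases h0 i with h | h
      · simp [hci, h] at hi
      · exact h hci
    · refine ht (Finset.mem_image.2 ⟨i, Finset.mem_univ _, ?_⟩)
      field_simp
      linear_combination -hi
  set l : Fin n → k := fun i => c i / (b i + t * c i)
  have hcl : ∀ i, c i = l i * (b i + t * c i) := fun i => (div_mul_cancel₀ _ (ht i)).symm
  have hbl : ∀ i, b i = (1 - t * l i) * (b i + t * c i) := fun i => by
    linear_combination - t * hcl i
  have hinj : Function.Injective l := by
    intro i j hij
    by_contra h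
    apply hne i j h
    have := (div_eq_div_iff (ht i) (ht j)).1 hij
    linear_combination -this
  have hp : ∀ i, ∏ j ∈ Finset.univ.erase i, (l i - l j) ≠ 0 := by
    intro i
    refine Finset.prod_ne_zero_iff.2 fun j hj => sub_ne_zero.2 fun h => ?_
    exact (Finset.ne_of_mem_erase hj) (hinj h).symm
  choose y hy using fun i => IsAlgClosed.exists_pow_nat_eq
    ((b i + t * c i)⁻¹ * (∏ j ∈ Finset.univ.erase i, (l i - l j))⁻¹) (n := 2) (by norm_num)
  have hy0 : ∀ i, y i ≠ 0 := by
    intro i h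
    have h1 := hy i
    rw [h, zero_pow two_ne_zero] at h1
    exact mul_ne_zero (inv_ne_zero (ht i)) (inv_ne_zero (hp i)) h1.symm
  let Φ : degreeLT k m →ₗ[k] V :=
    (∑ i, (y i • Polynomial.leval (l i)).smulRight (e i)) ∘ₗ (degreeLT k m).subtype
  have hΦ : ∀ a, Φ a = ∑ i, (y i * (a : k[X]).eval (l i)) • e i := by
    intro a
    simp [Φ, Polynomial.leval]
  have hψΦ : ∀ a i, ψ i (Φ a) = y i * (a : k[X]).eval (l i) := by
    intro a i
    simp [hΦ, hψ]
  have hdeg : ∀ a : degreeLT k m, a ≠ 0 → (a : k[X]).natDegree < m := by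
    intro a ha
    exact (natDegree_lt_iff_degree_lt (by simpa using ha)).2 (mem_degreeLT.1 a.2)
  have hΦinj : Function.Injective Φ := by
    rw [← ker_eq_bot, Submodule.eq_bot_iff]
    intro a ha
    by_contra ha0
    have h1 : (a : k[X]) = 0 := by
      refine eq_zero_of_natDegree_lt_card_of_eval_eq_zero _ hinj (fun i => ?_) ?_
      · have := hψΦ a i
        rw [mem_ker.1 ha, map_zero] at this
        exact (mul_eq_zero.1 this.symm).resolve_left (hy0 i)
      · have := hdeg a ha0
        rw [Fintype.card_fin]
        omega
    exact ha0 (Subtype.ext h1)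
  have heval : ∀ (D : V →ₗ[k] V →ₗ[k] k) (d : Fin n → k) (Q : k[X]), (∀ i, D (e i) = d i • ψ i) →
      (∀ i, d i = Q.eval (l i) * (b i + t * c i)) → Q.natDegree ≤ 1 →
      ∀ a, D (Φ a) (Φ a) = 0 := by
    intro D d Q hd hdQ hQ a
    by_cases ha : a = 0
    · simp [ha]
    have hlt : (Q * (a : k[X]) ^ 2).natDegree + 1 < n := by
      have h1 := natDegree_mul_le (p := Q) (q := (a : k[X]) ^ 2)
      have h2 := natDegree_pow_le (p := (a : k[X])) (n := 2)
      have h3 := hdeg a ha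
      omega
    rw [← sum_eval_div_prod_sub_eq_zero hinj hlt]
    conv_lhs => enter [1]; rw [hΦ]
    simp only [map_sum, map_smul, hd, sum_apply, smul_apply, hψΦ, smul_eq_mul]
    refine Finset.sum_congr rfl fun i _ => ?_
    rw [hdQ, eval_mul, eval_pow]
    have h1 := hy i
    have h2 := ht i
    have h3 := hp i
    rw [← mul_inv, ← one_div, eq_div_iff (mul_ne_zero h2 h3)] at h1
    rw [eq_div_iff h3]
    linear_combination (eval (l i) Q * eval (l i) (a : k[X]) ^ 2) * h1
  refine ⟨range Φ, ?_, ?_⟩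
  · rw [finrank_range_of_inj hΦinj, (degreeLTEquiv k m).finrank_eq, Module.finrank_fin_fun]
  · rintro _ ⟨a, rfl⟩
    refine ⟨heval B b (1 - Polynomial.C t * X) hb (fun i => ?_) ?_ a, heval C c X hc (fun i => ?_) ?_ a⟩
    · simpa using hbl i
    · compute_degree
    · simpa using hcl i
    · exact natDegree_X_le

/-- Two symmetric bilinear forms on a space of dimension at least `2 * m + 1` over an
algebraically closed field have a common totally isotropic subspace of dimension `m`. -/
theorem exists_common_isotropic [IsAlgClosed k] (m : ℕ) :
    ∀ {V : Type u} [AddCommGroup V] [Module k V] [FiniteDimensional k V]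
      (B C : V →ₗ[k] V →ₗ[k] k), (∀ v w, B v w = B w v) → (∀ v w, C v w = C w v) →
      2 * m + 1 ≤ Module.finrank k V →
      ∃ W : Submodule k V, Module.finrank k W = m ∧ ∀ w ∈ W, B w w = 0 ∧ C w w = 0 := by
  induction m with
  | zero =>
    intro V _ _ _ B C _ _ _
    exact ⟨⊥, finrank_bot k V, by simp⟩
  | succ m ih =>
    intro V _ _ _ B C hB hC hV
    by_cases hS : HasSingularZero B C
    · obtain ⟨v, hv, hBv, hCv, ψ, s, t, hs, ht⟩ := hS
      obtain ⟨φ, hφ⟩ := Module.Projective.exists_dual_eq_one k hv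
      have hdim := finrank_le_finrank_ker_inf_ker_add_two ψ φ
      set U : Submodule k V := ker ψ ⊓ ker φ
      obtain ⟨W, hW, hiso⟩ := ih (B.domRestrict₁₂ U U) (C.domRestrict₁₂ U U)
        (fun x y => hB x y) (fun x y => hC x y) (by omega)
      have hvW : v ∉ W.map U.subtype := by
        rintro ⟨u, -, rfl⟩
        have : φ u = 0 := u.2.2
        simp [this] at hφ
      have hext : ∀ (D : V →ₗ[k] V →ₗ[k] k) (r : k), (∀ x y, D x y = D y x) → D v = r • ψ →
          D v v = 0 → ∀ (u : U) (a : k), D u u = 0 → D (u + a • v) (u + a • v) = 0 := by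
        intro D r hD hr hv u a hu
        have hvu : D v u = 0 := by
          have : ψ u = 0 := u.2.1
          simp [hr, this]
        simp [hu, hv, hvu, hD u v]
      refine ⟨W.map U.subtype ⊔ Submodule.span k {v}, ?_, ?_⟩
      · rw [Submodule.finrank_sup_span_singleton hvW,
          Submodule.finrank_map_subtype_eq, hW]
      · intro w hw
        obtain ⟨_, ⟨u, hu, rfl⟩, z, hz, rfl⟩ := Submodule.mem_sup.1 hw
        obtain ⟨a, rfl⟩ := Submodule.mem_span_singleton.1 hz
        exact ⟨hext B s hB hs hBv u a (hiso u hu).1, hext C t hC ht hCv u a (hiso u hu).2⟩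
    · exact exists_isotropic_of_not_hasSingularZero B C hB hC hS (m + 1) hV

end LinearMap

/-- Over an algebraically closed field of characteristic `≠ 2`, any two quadratic forms on
`k^n` (with `n ≥ 1`) vanish simultaneously on a subspace of dimension `⌊(n−1)/2⌋`.
Projectively: an intersection of two quadrics in `ℙ^{n−1}` contains a linear subspace of
projective dimension `⌊(n−3)/2⌋`. -/
theorem common_isotropic_subspace_algClosed {k : Type*} [Field k] [IsAlgClosed k]
    (h2 : (2 : k) ≠ 0) {n : ℕ} (hn : 1 ≤ n) (f g : QuadraticForm k (Fin n → k)) :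
    ∃ W : Submodule k (Fin n → k), Module.finrank k W = (n - 1) / 2 ∧
      ∀ w ∈ W, f w = 0 ∧ g w = 0 := by
  obtain ⟨W, hW, hiso⟩ := LinearMap.exists_common_isotropic ((n - 1) / 2)
    f.polarBilin g.polarBilin (fun v w => QuadraticMap.polar_comm f v w)
    (fun v w => QuadraticMap.polar_comm g v w) (by rw [Module.finrank_fin_fun]; omega)
  refine ⟨W, hW, fun w hw => ?_⟩
  have h := hiso w hw
  simpa [QuadraticMap.polar_self, h2] using h
end

section
/- Let n ≥ 5 and let f and g be positive definite quadratic forms on ℝ^{n−1}. Let X(ℝ) be the subset of the real projective space ℙ(ℝ^{n+1}) (the projectivization of ℝ^{n+1}, equipped with the quotient topology) consisting of the classes of nonzero vectors v = (v_0, v_1, v_2, …, v_n) ∈ ℝ^{n+1} satisfying f(v_2, …, v_n) − v_0·v_1 = 0 and g(v_2, …, v_n) − (v_0 − v_1)·(v_0 − 2·v_1) = 0. Then the topological space X(ℝ) has exactly two connected components. -/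
/-- The quotient topology on the real projectivization of `ℝ^m`, induced from the
subspace topology on `ℝ^m \ {0}`. -/
noncomputable instance (m : ℕ) : TopologicalSpace (Projectivization ℝ (Fin m → ℝ)) :=
  inferInstanceAs (TopologicalSpace (Quotient (projectivizationSetoid ℝ (Fin m → ℝ))))

section ConnectedComponents

variable {X : Type*} [TopologicalSpace X]

/-- A space covered by two connected sets lying in disjoint open sets has exactly two connected
components. -/
lemma ConnectedComponents.card_eq_two {A B U V : Set X} (hA : IsConnected A) (hB : IsConnected B)
    (hU : IsOpen U) (hV : IsOpen V) (hUV : Disjoint U V) (hAU : A ⊆ U) (hBV : B ⊆ V)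
    (hAB : A ∪ B = Set.univ) : Nat.card (ConnectedComponents X) = 2 := by
  obtain ⟨a, ha⟩ := hA.nonempty
  obtain ⟨b, hb⟩ := hB.nonempty
  refine Nat.card_eq_two_iff.2 ⟨a, b, fun hab => ?_, ?_⟩
  · have hcompl : Uᶜ = V := by
      refine Set.Subset.antisymm (fun x hx => ?_) hUV.subset_compl_left
      exact (hAB.symm ▸ Set.mem_univ x : x ∈ A ∪ B).elim (fun h => (hx (hAU h)).elim) (@hBV x)
    have hclopen : IsClopen U := ⟨⟨hcompl ▸ hV⟩, hU⟩
    have hbU : b ∈ U := hclopen.connectedComponent_subset (hAU ha)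
      (ConnectedComponents.coe_eq_coe'.1 hab.symm)
    exact Set.disjoint_left.1 hUV hbU (hBV hb)
  · refine Set.eq_univ_of_forall fun q => ?_
    obtain ⟨x, rfl⟩ := ConnectedComponents.surjective_coe q
    rcases (hAB.symm ▸ Set.mem_univ x : x ∈ A ∪ B) with hx | hx
    · exact Or.inl (ConnectedComponents.coe_eq_coe'.2
        (hA.isPreconnected.subset_connectedComponent ha hx))
    · exact Or.inr (ConnectedComponents.coe_eq_coe'.2
        (hB.isPreconnected.subset_connectedComponent hb hx))

end ConnectedComponents

lemma QuadraticForm.continuous_of_finiteDimensional {m : ℕ}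
    (f : QuadraticForm ℝ (Fin m → ℝ)) : Continuous f := by
  have h : (f : (Fin m → ℝ) → ℝ) =
      fun x => LinearMap.toContinuousBilinearMap (QuadraticMap.associated (R := ℝ) f) x x := by
    ext x
    exact (QuadraticMap.associated_eq_self_apply ℝ f x).symm
  rw [h]
  fun_prop

/-- The solutions of `x c = a (x - 1) (x - 2)`, for `ε = -1` and `ε = 1`. -/
noncomputable def sheetRatio (ε a c : ℝ) : ℝ :=
  (3 * a + c + ε * √((3 * a + c) ^ 2 - 8 * a ^ 2)) / (2 * a)

section sheetRatio

variable {a c : ℝ}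

lemma sq_lt_sheetRatio_discrim (ha : 0 < a) (hc : 0 < c) : c ^ 2 < (3 * a + c) ^ 2 - 8 * a ^ 2 := by
  nlinarith [mul_pos ha hc, mul_pos ha ha]

lemma lt_sqrt_sheetRatio_discrim (ha : 0 < a) (hc : 0 < c) : c < √((3 * a + c) ^ 2 - 8 * a ^ 2) :=
  Real.lt_sqrt_of_sq_lt (sq_lt_sheetRatio_discrim ha hc)

lemma sqrt_sheetRatio_discrim_lt (ha : 0 < a) (hc : 0 < c) :
    √((3 * a + c) ^ 2 - 8 * a ^ 2) < 3 * a + c := by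
  rw [Real.sqrt_lt' (by positivity)]
  nlinarith [mul_pos ha ha]

lemma sheetRatio_eq_iff (ha : 0 < a) (hc : 0 < c) (s : ℝ) :
    s * c = a * ((s - 1) * (s - 2)) ↔ s = sheetRatio 1 a c ∨ s = sheetRatio (-1) a c := by
  have hd : discrim a (-(3 * a + c)) (2 * a) =
      √((3 * a + c) ^ 2 - 8 * a ^ 2) * √((3 * a + c) ^ 2 - 8 * a ^ 2) := by
    rw [Real.mul_self_sqrt ((sq_nonneg c).trans (sq_lt_sheetRatio_discrim ha hc).le), discrim]
    ring
  have h := quadratic_eq_zero_iff ha.ne' hd s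
  simp only [neg_neg] at h
  simp only [sheetRatio, one_mul, neg_one_mul, ← sub_eq_add_neg]
  rw [← h]
  constructor <;> intro h <;> linarith

lemma sheetRatio_neg_one_pos (ha : 0 < a) (hc : 0 < c) : 0 < sheetRatio (-1) a c := by
  have := sqrt_sheetRatio_discrim_lt ha hc
  exact div_pos (by linarith) (by linarith)

lemma sheetRatio_neg_one_lt (ha : 0 < a) (hc : 0 < c) : sheetRatio (-1) a c < 3 / 2 := by
  have := lt_sqrt_sheetRatio_discrim ha hc
  rw [sheetRatio, div_lt_iff₀ (by linarith)]
  linarith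

lemma lt_sheetRatio_one (ha : 0 < a) (hc : 0 < c) : 3 / 2 < sheetRatio 1 a c := by
  have := lt_sqrt_sheetRatio_discrim ha hc
  rw [sheetRatio, lt_div_iff₀ (by linarith)]
  linarith

end sheetRatio

section affineChart

variable {m : ℕ}

/-- The vector `(s, 1, w)`. -/
def affineVec (s : ℝ) (w : Fin m → ℝ) : Fin (m + 2) → ℝ :=
  Fin.cons s (Fin.cons 1 w)

@[simp] lemma affineVec_zero (s : ℝ) (w : Fin m → ℝ) : affineVec s w 0 = s := rfl

@[simp] lemma affineVec_one (s : ℝ) (w : Fin m → ℝ) : affineVec s w 1 = 1 := rfl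

@[simp] lemma affineVec_succ_succ (s : ℝ) (w : Fin m → ℝ) (i : Fin m) :
    affineVec s w i.succ.succ = w i := rfl

lemma affineVec_ne_zero (s : ℝ) (w : Fin m → ℝ) : affineVec s w ≠ 0 :=
  fun h => one_ne_zero (α := ℝ) (congrFun h 1)

lemma Projectivization.continuous_mk' {k : ℕ} :
    Continuous (Projectivization.mk' ℝ : {v : Fin k → ℝ // v ≠ 0} → _) :=
  continuous_quotient_mk'

lemma Projectivization.isOpen_setOfPred_mk {k : ℕ} {S : Set (Fin k → ℝ)} (hS : IsOpen S)
    (hsmul : ∀ (t : ℝ) (v : Fin k → ℝ), t • v ∈ S → v ∈ S) :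
    IsOpen {P : Projectivization ℝ (Fin k → ℝ) | ∃ v hv, P = .mk ℝ v hv ∧ v ∈ S} := by
  refine isOpen_coinduced.2 ?_
  convert hS.preimage (continuous_subtype_val (p := fun v : Fin k → ℝ => v ≠ 0)) using 1
  ext ⟨v, hv⟩
  constructor
  · rintro ⟨w, hw, h, hwS⟩
    obtain ⟨t, rfl⟩ := (Projectivization.mk_eq_mk_iff' ℝ w v hw hv).1 h.symm
    exact hsmul t v hwS
  · exact fun h => ⟨v, hv, rfl, h⟩

/-- The intersection of the quadrics `f(v₂,…) = v₀v₁` and `g(v₂,…) = (v₀ - v₁)(v₀ - 2v₁)`. -/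
def quadricIntersection (f g : QuadraticForm ℝ (Fin m → ℝ)) :
    Set (Projectivization ℝ (Fin (m + 2) → ℝ)) :=
  {P | ∃ (v : Fin (m + 2) → ℝ) (hv : v ≠ 0), P = .mk ℝ v hv ∧
    f (fun i => v i.succ.succ) - v 0 * v 1 = 0 ∧
    g (fun i => v i.succ.succ) - (v 0 - v 1) * (v 0 - 2 * v 1) = 0}

variable {f g : QuadraticForm ℝ (Fin m → ℝ)}

lemma exists_affineVec_of_mem_quadricIntersection (hf : f.PosDef)
    {P : Projectivization ℝ (Fin (m + 2) → ℝ)} (hP : P ∈ quadricIntersection f g) :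
    ∃ (s : ℝ) (w : Fin m → ℝ), P = .mk ℝ (affineVec s w) (affineVec_ne_zero s w) ∧
      w ≠ 0 ∧ f w = s ∧ g w = (s - 1) * (s - 2) := by
  obtain ⟨v, hv, rfl, h₁, h₂⟩ := hP
  set w : Fin m → ℝ := fun i => v i.succ.succ with hw
  have ht : v 1 ≠ 0 := by
    intro ht
    rw [ht, mul_zero, sub_zero] at h₁
    have hw0 : w = 0 := hf.anisotropic _ h₁
    have hs : v 0 = 0 := by simpa [hw0, ht] using h₂
    refine hv (funext fun i => ?_)
    refine Fin.cases hs (fun i => ?_) i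
    exact Fin.cases ht (fun i => congrFun hw0 i) i
  have hfw : f ((v 1)⁻¹ • w) = v 0 / v 1 := by
    rw [QuadraticMap.map_smul, sub_eq_zero.1 h₁, smul_eq_mul]
    field_simp
  have hgw : g ((v 1)⁻¹ • w) = (v 0 / v 1 - 1) * (v 0 / v 1 - 2) := by
    rw [QuadraticMap.map_smul, sub_eq_zero.1 h₂, smul_eq_mul]
    field_simp
  refine ⟨v 0 / v 1, (v 1)⁻¹ • w, ?_, fun h0 => ?_, hfw, hgw⟩
  · refine (Projectivization.mk_eq_mk_iff' ℝ _ _ _ _).2 ⟨v 1, funext fun i => ?_⟩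
    refine Fin.cases ?_ (fun i => Fin.cases ?_ (fun i => ?_) i) i
    · simp [mul_div_cancel₀, ht]
    · change v 1 * 1 = v 1
      rw [mul_one]
    · simp [hw, ht]
  · rw [h0, QuadraticMap.map_zero] at hfw hgw
    rw [← hfw] at hgw
    norm_num at hgw

/-- The point of the sheet `ε` of the intersection of the two quadrics lying over the ray
through `w`. -/
noncomputable def sheetVec (f g : QuadraticForm ℝ (Fin m → ℝ)) (ε : ℝ) (w : Fin m → ℝ) :
    Fin (m + 2) → ℝ :=
  affineVec (sheetRatio ε (f w) (g w)) (√(sheetRatio ε (f w) (g w) / f w) • w)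

lemma continuousOn_sheetVec (hf : f.PosDef) (ε : ℝ) :
    ContinuousOn (sheetVec f g ε) {0}ᶜ := by
  have hfc := f.continuous_of_finiteDimensional
  have hgc := g.continuous_of_finiteDimensional
  have h0 : ∀ w ∈ ({0}ᶜ : Set (Fin m → ℝ)), f w ≠ 0 := fun w hw => (hf w hw).ne'
  have hs : ContinuousOn (fun w => sheetRatio ε (f w) (g w)) {0}ᶜ := by
    unfold sheetRatio
    exact ContinuousOn.div (by fun_prop) (by fun_prop) fun w hw => mul_ne_zero two_ne_zero (h0 w hw)
  refine continuousOn_pi.2 fun i => ?_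
  refine Fin.cases hs (fun i => Fin.cases continuousOn_const (fun i => ?_) i) i
  exact ((hs.div hfc.continuousOn h0).sqrt).mul (continuous_apply i).continuousOn

lemma mk_sheetVec_mem_quadricIntersection (hf : f.PosDef) (hg : g.PosDef) {ε : ℝ}
    (hε : ε = 1 ∨ ε = -1) {w : Fin m → ℝ} (hw : w ≠ 0) :
    Projectivization.mk ℝ (sheetVec f g ε w) (affineVec_ne_zero _ _) ∈
      quadricIntersection f g := by
  have ha := hf w hw
  have hc := hg w hw
  have hpos : 0 < sheetRatio ε (f w) (g w) := by
    rcases hε with rfl | rfl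
    · exact (by norm_num : (0 : ℝ) < 3 / 2).trans (lt_sheetRatio_one ha hc)
    · exact sheetRatio_neg_one_pos ha hc
  have hroot := (sheetRatio_eq_iff ha hc (sheetRatio ε (f w) (g w))).2 (by
    rcases hε with rfl | rfl
    · exact Or.inl rfl
    · exact Or.inr rfl)
  refine ⟨_, affineVec_ne_zero _ _, rfl, ?_, ?_⟩
  · simp only [affineVec_succ_succ, affineVec_zero, affineVec_one]
    rw [QuadraticMap.map_smul, Real.mul_self_sqrt (by positivity), smul_eq_mul]
    field_simp
    ring
  · simp only [affineVec_succ_succ, affineVec_zero, affineVec_one]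
    rw [QuadraticMap.map_smul, Real.mul_self_sqrt (by positivity), smul_eq_mul]
    field_simp
    linarith

/-- The sheet `ε` of the intersection of the two quadrics. -/
def sheet (f g : QuadraticForm ℝ (Fin m → ℝ)) (ε : ℝ) : Set (quadricIntersection f g) :=
  {P | ∃ w : Fin m → ℝ, w ≠ 0 ∧
    P.1 = .mk ℝ (sheetVec f g ε w) (affineVec_ne_zero _ _)}

lemma isConnected_sheet (hm : 2 ≤ m) (hf : f.PosDef) (hg : g.PosDef) {ε : ℝ}
    (hε : ε = 1 ∨ ε = -1) : IsConnected (sheet f g ε) := by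
  have hconn : IsConnected ({0}ᶜ : Set (Fin m → ℝ)) :=
    isConnected_compl_singleton_of_one_lt_rank (by simpa using Nat.lt_of_succ_le hm) 0
  have := isConnected_iff_connectedSpace.1 hconn
  let φ : ({0}ᶜ : Set (Fin m → ℝ)) → quadricIntersection f g := fun w =>
    ⟨_, mk_sheetVec_mem_quadricIntersection hf hg hε w.2⟩
  have hφ : Continuous φ :=
    (Projectivization.continuous_mk'.comp
      ((continuousOn_iff_continuous_domRestrict.1 (continuousOn_sheetVec hf ε)).subtype_mk
        fun _ => affineVec_ne_zero _ _)).subtype_mk _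
  convert isConnected_range hφ
  ext P
  exact ⟨fun ⟨w, hw, h⟩ => ⟨⟨w, hw⟩, Subtype.ext h.symm⟩,
    fun ⟨w, h⟩ => ⟨w, w.2, congrArg Subtype.val h.symm⟩⟩

lemma sheet_union_sheet (hf : f.PosDef) (hg : g.PosDef) :
    sheet f g (-1) ∪ sheet f g 1 = Set.univ := by
  refine Set.eq_univ_of_forall fun ⟨P, hP⟩ => ?_
  obtain ⟨s, w, rfl, hw, hfw, hgw⟩ := exists_affineVec_of_mem_quadricIntersection hf hP
  have ha := hf w hw
  have key : ∀ ε, s = sheetRatio ε (f w) (g w) → sheetVec f g ε w = affineVec s w := by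
    intro ε h
    rw [sheetVec, ← h, hfw, div_self (hfw ▸ ha.ne'), Real.sqrt_one, one_smul]
  rcases (sheetRatio_eq_iff ha (hg w hw) s).1 (by rw [hfw, hgw]) with h | h
  · exact Or.inr ⟨w, hw, by simp only [key 1 h]⟩
  · exact Or.inl ⟨w, hw, by simp only [key (-1) h]⟩

theorem card_connectedComponents_quadricIntersection (hm : 2 ≤ m) (hf : f.PosDef)
    (hg : g.PosDef) : Nat.card (ConnectedComponents (quadricIntersection f g)) = 2 := by
  let S : Set (Fin (m + 2) → ℝ) := {v | 2 * (v 0 * v 1) < 3 * v 1 ^ 2}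
  let T : Set (Fin (m + 2) → ℝ) := {v | 3 * v 1 ^ 2 < 2 * (v 0 * v 1)}
  have hS : IsOpen S := isOpen_lt (by fun_prop) (by fun_prop)
  have hT : IsOpen T := isOpen_lt (by fun_prop) (by fun_prop)
  have hSsmul : ∀ (t : ℝ) (v : Fin (m + 2) → ℝ), t • v ∈ S → v ∈ S := by
    intro t v h
    simp only [S, Set.mem_ofPred_eq, Pi.smul_apply, smul_eq_mul] at h ⊢
    by_contra! h'
    nlinarith [mul_le_mul_of_nonneg_left h' (sq_nonneg t)]
  have hTsmul : ∀ (t : ℝ) (v : Fin (m + 2) → ℝ), t • v ∈ T → v ∈ T := by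
    intro t v h
    simp only [T, Set.mem_ofPred_eq, Pi.smul_apply, smul_eq_mul] at h ⊢
    by_contra! h'
    nlinarith [mul_le_mul_of_nonneg_left h' (sq_nonneg t)]
  refine ConnectedComponents.card_eq_two (isConnected_sheet hm hf hg (Or.inr rfl))
    (isConnected_sheet hm hf hg (Or.inl rfl))
    ((Projectivization.isOpen_setOfPred_mk hS hSsmul).preimage continuous_subtype_val)
    ((Projectivization.isOpen_setOfPred_mk hT hTsmul).preimage continuous_subtype_val)
    ?_ ?_ ?_ (sheet_union_sheet hf hg)
  · refine Set.disjoint_left.2 ?_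
    rintro P ⟨v, hv, h, hvS⟩ ⟨w, hw, h', hwT⟩
    obtain ⟨t, rfl⟩ := (Projectivization.mk_eq_mk_iff' ℝ _ _ _ _).1 (h.symm.trans h')
    exact lt_asymm (show 2 * (w 0 * w 1) < 3 * w 1 ^ 2 from hSsmul t w hvS) hwT
  · rintro P ⟨w, hw, h⟩
    refine ⟨_, _, h, ?_⟩
    have := sheetRatio_neg_one_lt (hf w hw) (hg w hw)
    simp only [S, Set.mem_ofPred_eq, sheetVec, affineVec_zero, affineVec_one]
    linarith
  · rintro P ⟨w, hw, h⟩
    refine ⟨_, _, h, ?_⟩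
    have := lt_sheetRatio_one (hf w hw) (hg w hw)
    simp only [T, Set.mem_ofPred_eq, sheetVec, affineVec_zero, affineVec_one]
    linarith

end affineChart

/-- For `n ≥ 5` and positive definite quadratic forms `f, g` on `ℝ^{n−1}`, the real locus
`X(ℝ) ⊂ ℙ(ℝ^{n+1})` of the intersection of the two quadrics `f(v₂,…,vₙ) − v₀v₁ = 0` and
`g(v₂,…,vₙ) − (v₀−v₁)(v₀−2v₁) = 0` has exactly two connected components. -/
theorem real_intersection_two_connected_components {n : ℕ} (hn : 5 ≤ n)
    (f g : QuadraticForm ℝ (Fin (n - 1) → ℝ)) (hf : f.PosDef) (hg : g.PosDef) :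
    Nat.card (ConnectedComponents
      {P : Projectivization ℝ (Fin (n + 1) → ℝ) //
        ∃ (v : Fin (n + 1) → ℝ) (hv : v ≠ 0), P = Projectivization.mk ℝ v hv ∧
          f (fun i => v ⟨i.1 + 2, by have := i.2; omega⟩) -
            v ⟨0, by omega⟩ * v ⟨1, by omega⟩ = 0 ∧
          g (fun i => v ⟨i.1 + 2, by have := i.2; omega⟩) -
            (v ⟨0, by omega⟩ - v ⟨1, by omega⟩) *
              (v ⟨0, by omega⟩ - 2 * v ⟨1, by omega⟩) = 0}) = 2 := by
  obtain ⟨m, rfl⟩ : ∃ m, n = m + 1 := ⟨n - 1, by omega⟩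
  exact card_connectedComponents_quadricIntersection (m := m) (by omega) hf hg
end

section
/- Let n ≥ 5 and let f and g be positive definite quadratic forms on ℝ^{n−1}. Let F and G be the quadratic forms on ℂ^{n+1} given by F(v) = f_ℂ(v_2, …, v_n) − v_0·v_1 and G(v) = g_ℂ(v_2, …, v_n) − (v_0 − v_1)·(v_0 − 2·v_1), where f_ℂ and g_ℂ are the base changes of f and g to ℂ. Let m = ⌊(n−3)/2⌋. Then there exists a ℂ-subspace W of ℂ^{n+1} of dimension m + 1 on which F and G vanish identically and such that W ∩ σ(W) = {0}, where σ : ℂ^{n+1} → ℂ^{n+1} is coordinatewise complex conjugation. (Projectively: the complexified intersection of two quadrics contains a linear subspace ℙ^m that does not meet its complex conjugate.) -/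
open Polynomial in
theorem Polynomial.sum_eval_div_prod_sub_eq_zero {K ι : Type*} [Field K] [DecidableEq ι]
    {s : Finset ι} {μ : ι → K} (hμ : Set.InjOn μ s) {P : K[X]} (hP : P.natDegree + 1 < s.card) :
    ∑ i ∈ s, P.eval (μ i) / ∏ j ∈ s.erase i, (μ i - μ j) = 0 := by
  rw [← Lagrange.coeff_eq_sum hμ, Polynomial.coeff_eq_zero_of_natDegree_lt (by omega)]
  exact Polynomial.degree_le_natDegree.trans_lt (by exact_mod_cast (by omega))

open Polynomial in
/-- Two simultaneously diagonal quadratic forms with distinct ratios have a common isotropic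
subspace, consisting of the suitably rescaled value vectors of polynomials of small degree. -/
theorem exists_isotropic_diagonal_of_injOn {K ι : Type*} [Field K] [IsAlgClosed K] [Fintype ι]
    [DecidableEq ι] {μ : ι → K} {k : ℕ} {s : Finset ι} (hs : 2 * k + 1 ≤ s.card)
    (hμ : Set.InjOn μ s) :
    ∃ W : Submodule K (ι → K), Module.finrank K W = k ∧
      ∀ w ∈ W, (∀ i ∉ s, w i = 0) ∧ ∑ i ∈ s, w i ^ 2 = 0 ∧ ∑ i ∈ s, μ i * w i ^ 2 = 0 := by
  choose c hc using fun i => IsAlgClosed.exists_pow_nat_eq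
    ((∏ j ∈ s.erase i, (μ i - μ j))⁻¹) two_pos
  have hc0 : ∀ i ∈ s, c i ≠ 0 := by
    intro i hi h0
    have h := hc i
    rw [h0, zero_pow two_ne_zero, eq_comm, inv_eq_zero, Finset.prod_eq_zero_iff] at h
    obtain ⟨j, hj, hij⟩ := h
    rw [Finset.mem_erase] at hj
    exact hj.1 (hμ hj.2 hi (sub_eq_zero.mp hij).symm)
  let T : K[X] →ₗ[K] (ι → K) :=
    LinearMap.pi fun i => if i ∈ s then c i • Polynomial.leval (μ i) else 0
  have hT : ∀ p : K[X], ∀ i ∈ s, T p i = c i * p.eval (μ i) := by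
    intro p i hi
    simp [T, hi, Polynomial.leval]
  have hT0 : ∀ p : K[X], ∀ i ∉ s, T p i = 0 := by
    intro p i hi
    simp [T, hi]
  refine ⟨(Polynomial.degreeLT K k).map T, ?_, ?_⟩
  · have hinj : Function.Injective (T.domRestrict (Polynomial.degreeLT K k)) := by
      rw [← LinearMap.ker_eq_bot, LinearMap.ker_eq_bot']
      rintro ⟨p, hp⟩ h
      rw [Polynomial.mem_degreeLT] at hp
      ext1
      refine Polynomial.eq_zero_of_degree_lt_of_eval_index_eq_zero s hμ
        (hp.trans_le (by exact_mod_cast (by omega))) fun i hi => ?_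
      have h' : T p i = 0 := congrFun h i
      rw [hT p i hi] at h'
      exact (mul_eq_zero.mp h').resolve_left (hc0 i hi)
    rw [← LinearMap.range_domRestrict, LinearMap.finrank_range_of_inj hinj,
      (Polynomial.degreeLTEquiv K k).finrank_eq, Module.finrank_fin_fun]
  · rintro _ ⟨p, hp, rfl⟩
    refine ⟨hT0 p, ?_⟩
    rcases eq_or_ne p 0 with rfl | hp0
    · simp
    have hdeg : p.natDegree < k :=
      (Polynomial.natDegree_lt_iff_degree_lt hp0).mpr (Polynomial.mem_degreeLT.mp hp)
    have h2 : (p ^ 2).natDegree ≤ 2 * p.natDegree := Polynomial.natDegree_pow_le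
    have h3 : (X * p ^ 2).natDegree ≤ 1 + (p ^ 2).natDegree :=
      Polynomial.natDegree_mul_le_of_le Polynomial.natDegree_X_le le_rfl
    constructor
    · rw [← Polynomial.sum_eval_div_prod_sub_eq_zero hμ (P := p ^ 2) (by omega)]
      refine Finset.sum_congr rfl fun i hi => ?_
      rw [hT p i hi, mul_pow, hc, Polynomial.eval_pow, div_eq_inv_mul]
    · rw [← Polynomial.sum_eval_div_prod_sub_eq_zero hμ (P := X * p ^ 2) (by omega)]
      refine Finset.sum_congr rfl fun i hi => ?_
      rw [hT p i hi, mul_pow, hc, Polynomial.eval_mul, Polynomial.eval_pow, Polynomial.eval_X,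
        div_eq_inv_mul]
      ring

/-- Two diagonal quadratic forms in at least `2 * k + 1` variables over an algebraically closed
field have a common isotropic subspace of dimension `k`. -/
theorem exists_isotropic_diagonal {K ι : Type*} [Field K] [IsAlgClosed K] [Fintype ι]
    [DecidableEq ι] (μ : ι → K) (k : ℕ) (s : Finset ι) (hs : 2 * k + 1 ≤ s.card) :
    ∃ W : Submodule K (ι → K), Module.finrank K W = k ∧
      ∀ w ∈ W, (∀ i ∉ s, w i = 0) ∧ ∑ i ∈ s, w i ^ 2 = 0 ∧ ∑ i ∈ s, μ i * w i ^ 2 = 0 := by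
  induction k generalizing s with
  | zero => exact ⟨⊥, finrank_bot K _, by simp⟩
  | succ k ih =>
    by_cases hμ : Set.InjOn μ s
    · exact exists_isotropic_diagonal_of_injOn hs hμ
    simp only [Set.InjOn, not_forall] at hμ
    obtain ⟨i, hi, j, hj, hij, hne⟩ := hμ
    rw [Finset.mem_coe] at hi hj
    have hj' : j ∈ s.erase i := Finset.mem_erase.mpr ⟨Ne.symm hne, hj⟩
    obtain ⟨W, hW, hWs⟩ := ih ((s.erase i).erase j) (by
      rw [Finset.card_erase_of_mem hj', Finset.card_erase_of_mem hi]
      omega)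
    obtain ⟨I, hI⟩ := IsAlgClosed.exists_pow_nat_eq (-1 : K) two_pos
    have hi0 : ∀ w ∈ W, w i = 0 := fun w hw => (hWs w hw).1 i (by simp)
    have hj0 : ∀ w ∈ W, w j = 0 := fun w hw => (hWs w hw).1 j (by simp)
    let u : ι → K := Pi.single i 1 + Pi.single j I
    have hui : u i = 1 := by simp [u, hne]
    have huj : u j = I := by simp [u, Ne.symm hne]
    have hu0 : ∀ l, l ≠ i → l ≠ j → u l = 0 := fun l h1 h2 => by simp [u, h1, h2]
    refine ⟨W ⊔ Submodule.span K {u}, ?_, ?_⟩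
    · rw [Submodule.finrank_sup_span_singleton, hW]
      intro hu
      exact one_ne_zero (hui.symm.trans (hi0 u hu))
    · intro w hw
      obtain ⟨x, hx, y, hy, rfl⟩ := Submodule.mem_sup.mp hw
      obtain ⟨a, rfl⟩ := Submodule.mem_span_singleton.mp hy
      obtain ⟨hx0, hx1, hx2⟩ := hWs x hx
      have hval : ∀ l ∈ (s.erase i).erase j, (x + a • u) l = x l := by
        intro l hl
        simp only [Finset.mem_erase] at hl
        simp [hu0 l hl.2.1 hl.1]
      have hvi : (x + a • u) i = a := by simp [hui, hi0 x hx]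
      have hvj : (x + a • u) j = a * I := by simp [huj, hj0 x hx]
      refine ⟨?_, ?_, ?_⟩
      · intro l hl
        have hli : l ≠ i := fun h => hl (h ▸ hi)
        have hlj : l ≠ j := fun h => hl (h ▸ hj)
        simp [hu0 l hli hlj, hx0 l (by simp [hl])]
      · rw [← Finset.add_sum_erase s _ hi, ← Finset.add_sum_erase _ _ hj', hvi, hvj,
          Finset.sum_congr rfl fun l hl => by rw [hval l hl], hx1]
        linear_combination a ^ 2 * hI
      · rw [← Finset.add_sum_erase s _ hi, ← Finset.add_sum_erase _ _ hj', hvi, hvj,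
          Finset.sum_congr rfl fun l hl => by rw [hval l hl], hx2, hij]
        linear_combination μ j * a ^ 2 * hI

/-- Simultaneous diagonalization of a positive definite real form and another real form. -/
theorem QuadraticMap.PosDef.exists_diagonal {V : Type*} [AddCommGroup V] [Module ℝ V]
    [FiniteDimensional ℝ V] {N : ℕ} (hN : Module.finrank ℝ V = N) {f : QuadraticForm ℝ V}
    (hf : f.PosDef) (g : QuadraticForm ℝ V) :
    ∃ (b : Fin N → V) (μ : Fin N → ℝ),
      (∀ i j, QuadraticMap.associated f (b i) (b j) = if i = j then 1 else 0) ∧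
      (∀ i j, QuadraticMap.associated g (b i) (b j) = if i = j then μ i else 0) := by
  let B : LinearMap.BilinForm ℝ V := QuadraticMap.associated f
  let C : LinearMap.BilinForm ℝ V := QuadraticMap.associated g
  have hB : ∀ x, B x x = f x := fun x => QuadraticMap.associated_eq_self_apply ℝ f x
  have hBs : ∀ x y, B x y = B y x := QuadraticMap.associated_isSymm ℝ f
  have hCs : ∀ x y, C x y = C y x := QuadraticMap.associated_isSymm ℝ g
  let core : InnerProductSpace.Core ℝ V :=
    { inner := fun x y => B x y
      conj_inner_symm := fun x y => hBs y x
      re_inner_nonneg := fun x => (hB x).symm ▸ hf.nonneg x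
      add_left := fun x y z => by simp
      smul_left := fun x y r => by simp
      definite := fun x hx => hf.anisotropic x ((hB x).symm.trans hx) }
  let : NormedAddCommGroup V := core.toNormedAddCommGroup
  let : InnerProductSpace ℝ V := InnerProductSpace.ofCore core.toCore
  have hinner : ∀ x y : V, inner ℝ x y = B x y := fun _ _ => rfl
  have hBn : B.Nondegenerate :=
    (LinearMap.IsSymm.isRefl ⟨hBs⟩).nondegenerate_iff_separatingLeft.mpr
      (QuadraticMap.separatingLeft_of_anisotropic f hf.anisotropic)
  let T := LinearMap.BilinForm.symmCompOfNondegenerate C B hBn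
  have hTB : ∀ x y, B (T x) y = C x y := fun x y =>
    LinearMap.BilinForm.symmCompOfNondegenerate_left_apply C hBn y x
  have hT : T.IsSymmetric := fun x y => by
    rw [hinner, hinner, hTB, hBs, hTB, hCs]
  let b := hT.eigenvectorBasis hN
  have hb : ∀ i j, B (b i) (b j) = if i = j then 1 else 0 := fun i j =>
    (hinner _ _).symm.trans (orthonormal_iff_ite.mp b.orthonormal i j)
  refine ⟨b, hT.eigenvalues hN, hb, fun i j => ?_⟩
  change C (b i) (b j) = _
  rw [← hTB, hT.apply_eigenvectorBasis, map_smul, LinearMap.smul_apply, hb]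
  simp

theorem QuadraticForm.baseChangePi_algebraMap {k : Type*} [Field k] (K : Type*) [Field K]
    [Algebra k K] (h2 : (2 : k) ≠ 0) {n : ℕ} (Q : QuadraticForm k (Fin n → k)) (x : Fin n → k) :
    QuadraticForm.baseChangePi K h2 Q (fun i => algebraMap k K (x i)) = algebraMap k K (Q x) := by
  have h := TensorProduct.piScalarRight_symm_algebraMap k K (Fin n) (N := K) x
  have hx : (fun i => algebraMap k K (x i)) = algebraMap (Fin n → k) (Fin n → K) x := rfl
  let : Invertible (2 : k) := invertibleOfNonzero h2
  rw [hx, QuadraticForm.baseChangePi, QuadraticMap.comp_apply, LinearEquiv.coe_coe, h,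
    QuadraticForm.baseChange_tmul, mul_one, Algebra.smul_def, mul_one]

theorem QuadraticMap.associated_sum_smul_right {K E ι : Type*} [Field K] [Invertible (2 : K)]
    [AddCommGroup E] [Module K E] [Fintype ι] [DecidableEq ι] (Q : QuadraticForm K E)
    {e : ι → E} {d : ι → K}
    (he : ∀ i j, QuadraticMap.associated Q (e i) (e j) = if i = j then d i else 0)
    (z : ι → K) (i : ι) :
    QuadraticMap.associated Q (e i) (∑ j, z j • e j) = z i * d i := by
  simp [map_sum, he]

theorem QuadraticMap.map_sum_smul_of_diagonal {K E ι : Type*} [Field K] [Invertible (2 : K)]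
    [AddCommGroup E] [Module K E] [Fintype ι] [DecidableEq ι] (Q : QuadraticForm K E)
    {e : ι → E} {d : ι → K}
    (he : ∀ i j, QuadraticMap.associated Q (e i) (e j) = if i = j then d i else 0)
    (z : ι → K) :
    Q (∑ i, z i • e i) = ∑ i, d i * z i ^ 2 := by
  rw [← QuadraticMap.associated_eq_self_apply K Q]
  conv_lhs => rw [LinearMap.map_sum₂]
  refine Finset.sum_congr rfl fun i _ => ?_
  rw [map_smul, LinearMap.smul_apply, QuadraticMap.associated_sum_smul_right Q he, smul_eq_mul]
  ring

theorem QuadraticMap.associated_ofReal {V ι : Type*} [AddCommGroup V] [Module ℝ V]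
    (Q : QuadraticForm ℂ (ι → ℂ)) (q : QuadraticForm ℝ V) (ρ : V →ₗ[ℝ] (ι → ℝ))
    (h : ∀ v, Q (fun i => (ρ v i : ℂ)) = q v) (x y : V) :
    QuadraticMap.associated Q (fun i => (ρ x i : ℂ)) (fun i => (ρ y i : ℂ)) =
      (QuadraticMap.associated q x y : ℝ) := by
  have hadd : (fun i => (ρ x i : ℂ)) + (fun i => (ρ y i : ℂ)) = fun i => (ρ (x + y) i : ℂ) := by
    ext i
    simp
  rw [QuadraticMap.associated_apply, QuadraticMap.associated_apply, hadd, h, h, h]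
  simp only [Module.End.smul_def, half_moduleEnd_apply_eq_half_smul]
  simp

/-- If `F` and `G` are real on the image of a real space `V`, with `F` positive definite there,
then they have a common isotropic subspace of dimension `k` without real vectors as soon as
`2 * k + 1 ≤ dim V`. -/
theorem exists_isotropic_disjoint_conj {V ι : Type*} [AddCommGroup V] [Module ℝ V]
    [FiniteDimensional ℝ V] (F G : QuadraticForm ℂ (ι → ℂ)) {f g : QuadraticForm ℝ V}
    (hf : f.PosDef) (ρ : V →ₗ[ℝ] (ι → ℝ)) (hF : ∀ v, F (fun i => (ρ v i : ℂ)) = f v)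
    (hG : ∀ v, G (fun i => (ρ v i : ℂ)) = g v) {k : ℕ} (hk : 2 * k + 1 ≤ Module.finrank ℝ V) :
    ∃ W : Submodule ℂ (ι → ℂ), Module.finrank ℂ W = k ∧ (∀ w ∈ W, F w = 0 ∧ G w = 0) ∧
      (W : Set (ι → ℂ)) ∩
        ((fun v : ι → ℂ => fun i => (starRingEnd ℂ) (v i)) '' (W : Set (ι → ℂ))) = {0} := by
  obtain ⟨b, μ, hbf, hbg⟩ := hf.exists_diagonal rfl g
  obtain ⟨W, hWk, hW⟩ := exists_isotropic_diagonal (fun i => (μ i : ℂ)) k Finset.univ (by simpa)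
  let e : Fin (Module.finrank ℝ V) → ι → ℂ := fun j i => (ρ (b j) i : ℂ)
  have heF : ∀ i j, QuadraticMap.associated F (e i) (e j) = if i = j then 1 else 0 := by
    intro i j
    rw [QuadraticMap.associated_ofReal F f ρ hF, hbf]
    split_ifs <;> simp
  have heG : ∀ i j, QuadraticMap.associated G (e i) (e j) = if i = j then (μ i : ℂ) else 0 := by
    intro i j
    rw [QuadraticMap.associated_ofReal G g ρ hG, hbg]
    split_ifs <;> simp
  let L := Fintype.linearCombination ℂ e
  have hL : ∀ z, L z = ∑ j, z j • e j := fun z => Fintype.linearCombination_apply ℂ e z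
  have hLinj : Function.Injective L := by
    intro z z' h
    ext i
    have h' := congrArg (QuadraticMap.associated F (e i)) h
    rw [hL, hL, QuadraticMap.associated_sum_smul_right F heF,
      QuadraticMap.associated_sum_smul_right F heF] at h'
    simpa using h'
  have hconj : ∀ z, (fun i => (starRingEnd ℂ) (L z i)) = L (fun j => (starRingEnd ℂ) (z j)) := by
    intro z
    ext i
    simp [hL, e]
  refine ⟨W.map L, ?_, ?_, ?_⟩
  · exact (W.equivMapOfInjective L hLinj).finrank_eq.symm.trans hWk
  · rintro _ ⟨z, hz, rfl⟩
    rw [hL, QuadraticMap.map_sum_smul_of_diagonal F heF,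
      QuadraticMap.map_sum_smul_of_diagonal G heG]
    simpa using (hW z hz).2
  · ext w
    constructor
    · rintro ⟨⟨z, hz, rfl⟩, _, ⟨y, hy, rfl⟩, hyz⟩
      have hyz' : (fun j => (starRingEnd ℂ) (y j)) = z := hLinj ((hconj y).symm.trans hyz)
      have h1 := (hW _ (W.add_mem hz hy)).2.1
      have h2 : ∑ j, Complex.normSq (y j) = 0 := by
        have hsq : ∀ j, (z + y) j ^ 2 = z j ^ 2 + y j ^ 2 + 2 * (Complex.normSq (y j) : ℂ) := by
          intro j
          rw [Complex.normSq_eq_conj_mul_self, Pi.add_apply, ← hyz']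
          ring
        rw [Finset.sum_congr rfl fun j _ => hsq j, Finset.sum_add_distrib, Finset.sum_add_distrib,
          (hW z hz).2.1, (hW y hy).2.1, ← Finset.mul_sum, zero_add, zero_add, mul_eq_zero,
          ← Complex.ofReal_sum, Complex.ofReal_eq_zero] at h1
        exact h1.resolve_left two_ne_zero
      rw [Finset.sum_eq_zero_iff_of_nonneg fun j _ => Complex.normSq_nonneg _] at h2
      have hz0 : z = 0 := by
        rw [← hyz']
        ext j
        simp [Complex.normSq_eq_zero.mp (h2 j (Finset.mem_univ j))]
      simp [hz0]
    · rintro rfl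
      exact ⟨zero_mem _, 0, zero_mem _, by ext; simp⟩

/-- For `n ≥ 5` and positive definite quadratic forms `f, g` on `ℝ^{n−1}`, the complexified
intersection of the two quadrics `F(v) = f_ℂ(v₂,…,vₙ) − v₀v₁` and
`G(v) = g_ℂ(v₂,…,vₙ) − (v₀−v₁)(v₀−2v₁)` contains a totally isotropic `ℂ`-subspace of
dimension `⌊(n−3)/2⌋ + 1` meeting its coordinatewise complex conjugate only in `0`;
projectively, a linear `ℙ^{⌊(n−3)/2⌋}` not meeting its complex conjugate. -/
theorem complex_subspace_disjoint_from_conjugate {n : ℕ} (hn : 5 ≤ n)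
    (f g : QuadraticForm ℝ (Fin (n - 1) → ℝ)) (hf : f.PosDef) (hg : g.PosDef)
    (F G : QuadraticForm ℂ (Fin (n + 1) → ℂ))
    (hF : ∀ v : Fin (n + 1) → ℂ,
      F v = (f.baseChangePi ℂ (by norm_num)) (fun i => v ⟨i.1 + 2, by have := i.2; omega⟩) -
        v ⟨0, by omega⟩ * v ⟨1, by omega⟩)
    (hG : ∀ v : Fin (n + 1) → ℂ,
      G v = (g.baseChangePi ℂ (by norm_num)) (fun i => v ⟨i.1 + 2, by have := i.2; omega⟩) -
        (v ⟨0, by omega⟩ - v ⟨1, by omega⟩) * (v ⟨0, by omega⟩ - 2 * v ⟨1, by omega⟩)) :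
    ∃ W : Submodule ℂ (Fin (n + 1) → ℂ),
      Module.finrank ℂ W = (n - 3) / 2 + 1 ∧
      (∀ w ∈ W, F w = 0 ∧ G w = 0) ∧
      (W : Set (Fin (n + 1) → ℂ)) ∩
        ((fun v : Fin (n + 1) → ℂ => fun i => (starRingEnd ℂ) (v i)) ''
          (W : Set (Fin (n + 1) → ℂ))) = {0} := by
  let ρ : ℝ × (Fin (n - 1) → ℝ) →ₗ[ℝ] (Fin (n + 1) → ℝ) := LinearMap.pi fun i =>
    if h0 : i.1 = 0 then -LinearMap.fst ℝ _ _
    else if h1 : i.1 = 1 then LinearMap.fst ℝ _ _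
    else LinearMap.proj ⟨i.1 - 2, by omega⟩ ∘ₗ LinearMap.snd ℝ _ _
  have hρ0 : ∀ v, ρ v ⟨0, by omega⟩ = -v.1 := fun v => by simp [ρ]
  have hρ1 : ∀ v, ρ v ⟨1, by omega⟩ = v.1 := fun v => by simp [ρ]
  have hρ2 : ∀ v (i : Fin (n - 1)), ρ v ⟨i.1 + 2, by omega⟩ = v.2 i := fun v i => by simp [ρ]
  have hsq : QuadraticMap.PosDef (QuadraticMap.sq : QuadraticForm ℝ ℝ) :=
    fun x hx => mul_self_pos.mpr hx
  refine exists_isotropic_disjoint_conj F G (g := ((-6 : ℝ) • QuadraticMap.sq (R := ℝ)).prod g)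
    (hsq.prod hf) ρ (fun v => ?_) (fun v => ?_) ?_
  · have h := QuadraticForm.baseChangePi_algebraMap ℂ two_ne_zero f v.2
    rw [Complex.coe_algebraMap] at h
    simp only [hF, hρ0, hρ1, hρ2, h, QuadraticMap.prod_apply, QuadraticMap.sq_apply]
    push_cast
    ring
  · have h := QuadraticForm.baseChangePi_algebraMap ℂ two_ne_zero g v.2
    rw [Complex.coe_algebraMap] at h
    simp only [hG, hρ0, hρ1, hρ2, h, QuadraticMap.prod_apply, _root_.smul_apply,
      QuadraticMap.sq_apply, smul_eq_mul]
    push_cast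
    ring
  · rw [Module.finrank_prod, Module.finrank_self, Module.finrank_fin_fun]
    omega
end

section
/- Call a list l of positive integers admissible for n = 5 if either l is empty, or l has odd length and the sum k of its entries satisfies k ≤ 6 and k is even. Consider the equivalence relation on admissible lists generated by cyclic permutation (l is equivalent to any rotation of l) and by reversal (l is equivalent to its reverse). Then there are exactly 9 equivalence classes of admissible lists for n = 5, represented by (), (2), (4), (2,1,1), (6), (4,1,1), (3,2,1), (2,2,2), and (2,1,1,1,1). -/
/-- A list of positive integers is admissible for `n = 5` if it is empty, or it has odd
length and its sum `k` satisfies `k ≤ 6` and `k` is even. -/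
def AdmissibleFive (l : List ℕ) : Prop :=
  (∀ x ∈ l, 0 < x) ∧ (l = [] ∨ (Odd l.length ∧ l.sum ≤ 6 ∧ Even l.sum))

/-- The elementary relation on lists generated by cyclic rotation and reversal. -/
def CycRevRel (l₁ l₂ : List ℕ) : Prop :=
  (∃ i, l₂ = l₁.rotate i) ∨ l₂ = l₁.reverse

theorem Relation.EqvGen.perm_of_cycRevRel {l₁ l₂ : List ℕ}
    (h : Relation.EqvGen CycRevRel l₁ l₂) : l₁.Perm l₂ := by
  induction h with
  | rel x y h =>
    rcases h with ⟨i, rfl⟩ | rfl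
    · exact (List.rotate_perm x i).symm
    · exact (List.reverse_perm x).symm
  | refl x => exact List.Perm.refl x
  | symm x y _ ih => exact ih.symm
  | trans x y z _ _ ih₁ ih₂ => exact ih₁.trans ih₂

/-- A decidable sufficient condition for `l` to be equivalent to a member of `reps`. -/
def DihedralTo (reps : List (List ℕ)) (l : List ℕ) : Prop :=
  ∃ r ∈ reps, ∃ i ∈ List.range 5, r = l.rotate i ∨ r = l.reverse.rotate i

instance (reps : List (List ℕ)) (l : List ℕ) : Decidable (DihedralTo reps l) := by
  unfold DihedralTo; infer_instance

theorem DihedralTo.exists_eqvGen {reps : List (List ℕ)} {l : List ℕ} (h : DihedralTo reps l) :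
    ∃ r ∈ reps, Relation.EqvGen CycRevRel l r := by
  obtain ⟨r, hr, i, -, h | h⟩ := h
  · exact ⟨r, hr, .rel _ _ (.inl ⟨i, h⟩)⟩
  · exact ⟨r, hr, .trans _ l.reverse _ (.rel _ _ (.inr rfl)) (.rel _ _ (.inl ⟨i, h⟩))⟩

theorem AdmissibleFive.dihedralTo {l : List ℕ} (hl : AdmissibleFive l) :
    DihedralTo [[], [2], [4], [2, 1, 1], [6], [4, 1, 1], [3, 2, 1], [2, 2, 2],
      [2, 1, 1, 1, 1]] l := by
  obtain ⟨hpos, rfl | ⟨hodd, hle, heven⟩⟩ := hl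
  · decide
  have hlen : l.length ≤ 6 := (List.length_le_sum_of_one_le l hpos).trans hle
  match l with
  | [] => decide
  | [a] =>
    simp only [List.mem_cons, forall_eq_or_imp, List.sum_cons, List.sum_nil, add_zero] at *
    obtain ⟨ha, -⟩ := hpos
    interval_cases a <;> revert heven <;> decide
  | [a, b, c] =>
    simp only [List.mem_cons, forall_eq_or_imp, List.sum_cons, List.sum_nil, add_zero] at *
    obtain ⟨ha, hb, hc, -⟩ := hpos
    have ha' : a ≤ 4 := by omega
    have hb' : b ≤ 4 := by omega
    have hc' : c ≤ 4 := by omega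
    interval_cases a <;> interval_cases b <;> interval_cases c <;>
      revert heven hle <;> clear * - <;> decide
  | [a, b, c, d, e] =>
    simp only [List.mem_cons, forall_eq_or_imp, List.sum_cons, List.sum_nil, add_zero] at *
    obtain ⟨ha, hb, hc, hd, he, -⟩ := hpos
    have ha' : a ≤ 2 := by omega
    have hb' : b ≤ 2 := by omega
    have hc' : c ≤ 2 := by omega
    have hd' : d ≤ 2 := by omega
    have he' : e ≤ 2 := by omega
    interval_cases a <;> interval_cases b <;> interval_cases c <;> interval_cases d <;>
      interval_cases e <;> revert heven hle <;> clear * - <;> decide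
  | [_, _] | [_, _, _, _] | [_, _, _, _, _, _] =>
    exact absurd hodd (by simp only [List.length_cons, List.length_nil]; decide)
  | _ :: _ :: _ :: _ :: _ :: _ :: _ :: _ =>
    simp only [List.length_cons] at hlen
    omega

/-- There are exactly 9 equivalence classes of admissible lists for `n = 5` under the
equivalence generated by cyclic permutation and reversal, represented by
`()`, `(2)`, `(4)`, `(2,1,1)`, `(6)`, `(4,1,1)`, `(3,2,1)`, `(2,2,2)`, `(2,1,1,1,1)`. -/
theorem admissible_five_nine_classes :
    ∃ reps : List (List ℕ),
      reps = [[], [2], [4], [2, 1, 1], [6], [4, 1, 1], [3, 2, 1], [2, 2, 2],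
        [2, 1, 1, 1, 1]] ∧
      reps.length = 9 ∧
      (∀ l ∈ reps, AdmissibleFive l) ∧
      (∀ l, AdmissibleFive l → ∃ r ∈ reps, Relation.EqvGen CycRevRel l r) ∧
      reps.Pairwise (fun r₁ r₂ => ¬ Relation.EqvGen CycRevRel r₁ r₂) := by
  refine ⟨_, rfl, rfl, ?_, fun l hl => hl.dihedralTo.exists_eqvGen, ?_⟩
  · unfold AdmissibleFive
    decide
  · refine List.Pairwise.imp (R := fun l₁ l₂ : List ℕ => ¬ l₁.Perm l₂)
      (fun h h' => h (Relation.EqvGen.perm_of_cycRevRel h')) ?_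
    decide
end
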